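/- arXiv:2604.15887 — 5 statements merged into one kernel-verified Lean document; each statement's English description precedes it below -/
import Mathlib

section
/- For every η ∈ (0,1) and every δ > 0 there exists θ ∈ (0,1) such that the following holds. Let X be a metric space, S ⊆ X compact, V a finite-dimensional real normed space, F : X → V Lipschitz, and W ⊆ V a linear subspace such that H¹(γ(Dom γ) ∩ S) = 0 for every curve fragment γ in the F-direction of E(W, θ). Let T : V → ℝ be a continuous linear map with W ⊆ ker T. Then for every ε > 0 and every Borel probability measure μ on X with μ(X ∖ S) = 0, there exist a function g : X → ℝ and a compact set E ⊆ S such that: (1) |g(y) − g(z)| ≤ |T(F(y)) − T(F(z))| + δ·‖T‖·Lip(F)·d(y,z) for all y, z ∈ X; (2) |T(F(x)) − g(x)| < ε for every x ∈ X; (3) μ(E) ≥ 1 − η and g(E) is a finite set. -/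
open MeasureTheory

/-- The "conical complement" `E(W, θ) = {v : dist(v, W) ≥ (1 − θ)‖v‖}`. -/
def conicalComplement {V : Type*} [NormedAddCommGroup V] [NormedSpace ℝ V]
    (W : Submodule ℝ V) (θ : ℝ) : Set V :=
  {v | (1 - θ) * ‖v‖ ≤ Metric.infDist v (W : Set V)}

/-- A curve fragment `γ` (with domain `K`) is in the `F`-direction of the set `D` if for
`H¹`-a.e. `t ∈ K`, the composition `F ∘ γ` has a derivative `v` at `t` within `K` and
`v ∈ D \ {0}`. -/
def InFDirection {X V : Type*} [MetricSpace X]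
    [NormedAddCommGroup V] [NormedSpace ℝ V]
    (F : X → V) (D : Set V) (γ : ℝ → X) (K : Set ℝ) : Prop :=
  ∀ᵐ t ∂((μH[1] : Measure ℝ).restrict K),
    ∃ v, HasDerivWithinAt (F ∘ γ) v K t ∧ v ∈ D ∧ v ≠ 0

open scoped NNReal ENNReal Topology

/-- If `h` has nonzero derivative on `K` and maps `K` to a null set, then `K` is null. -/
theorem volume_eq_zero_of_image_null {h : ℝ → ℝ} {K : Set ℝ}
    (hd : ∀ t ∈ K, deriv h t ≠ 0) (h0 : volume (h '' K) = 0) : volume K = 0 := by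
  have key : ∀ A : ℝ →L[ℝ] ℝ, ∃ r : ℝ≥0, r ≠ 0 ∧ (A.det ≠ 0 →
      ∀ s : Set ℝ, ApproximatesLinearOn h A s r → volume (h '' s) = 0 → volume s = 0) := by
    intro A
    by_cases hA : A.det = 0
    · exact ⟨1, one_ne_zero, fun h => (h hA).elim⟩
    obtain ⟨m, hm0, hm⟩ := ENNReal.lt_iff_exists_nnreal_btwn.1
      (ENNReal.ofReal_pos.2 (abs_pos.2 hA))
    obtain ⟨r, hr, hrpos⟩ :=
      ((mul_le_addHaar_image_of_lt_det volume A hm).and self_mem_nhdsWithin).exists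
    refine ⟨r, pos_iff_ne_zero.1 hrpos, fun _ s hs hs0 => ?_⟩
    have := hr s h hs
    rw [hs0, nonpos_iff_eq_zero, mul_eq_zero] at this
    exact this.resolve_left hm0.ne'
  choose r hr0 hr using key
  have hderiv : ∀ t ∈ K, HasFDerivWithinAt h (fderiv ℝ h t) K t := fun t ht =>
    (differentiableAt_of_deriv_ne_zero (hd t ht)).hasFDerivAt.hasFDerivWithinAt
  obtain ⟨t, A, -, -, hcover, happ, hA⟩ :=
    exists_partition_approximatesLinearOn_of_hasFDerivWithinAt h K _ hderiv r hr0
  rcases K.eq_empty_or_nonempty with rfl | hne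
  · simp
  have hpiece : ∀ n, volume (K ∩ t n) = 0 := fun n => by
    obtain ⟨y, hy, hAy⟩ := hA hne n
    refine hr (A n) ?_ _ (happ n) (measure_mono_null (Set.image_mono Set.inter_subset_left) h0)
    rw [hAy, ContinuousLinearMap.det, LinearMap.det_ring]
    simpa using hd y hy
  have : K = ⋃ n, K ∩ t n := by
    rw [← Set.inter_iUnion, Set.inter_eq_left.2 hcover]
  rw [this]
  exact measure_iUnion_null hpiece

theorem abs_apply_le_norm_mul_infDist {V : Type*} [NormedAddCommGroup V] [NormedSpace ℝ V]
    {W : Submodule ℝ V} {T : V →L[ℝ] ℝ} (hT : ∀ w ∈ W, T w = 0) (v : V) :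
    |T v| ≤ ‖T‖ * Metric.infDist v (W : Set V) := by
  rcases (norm_nonneg T).eq_or_lt with h | h
  · simp [norm_eq_zero.1 h.symm]
  rw [mul_comm, ← div_le_iff₀ h]
  refine (Metric.le_infDist ⟨0, W.zero_mem⟩).2 fun w hw => ?_
  rw [div_le_iff₀ h, mul_comm, dist_eq_norm]
  simpa [hT w hw] using T.le_opNorm (v - w)

theorem norm_le_of_hasDerivWithinAt_of_accPt {V : Type*} [NormedAddCommGroup V] [NormedSpace ℝ V]
    {φ : ℝ → V} {v : V} {K : Set ℝ} {t : ℝ} {C : ℝ≥0} (hφ : LipschitzOnWith C φ K)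
    (hd : HasDerivWithinAt φ v K t) (ht : t ∈ K) (hacc : AccPt t (Filter.principal K)) :
    ‖v‖ ≤ C := by
  have : (𝓝[K \ {t}] t).NeBot := (accPt_principal_iff_nhdsWithin).1 hacc
  refine le_of_tendsto (hasDerivWithinAt_iff_tendsto_slope.1 hd).norm ?_
  filter_upwards [self_mem_nhdsWithin] with s hs
  have hst : 0 < ‖s - t‖ := norm_pos_iff.2 (sub_ne_zero.2 hs.2)
  rw [slope_def_module, norm_smul, norm_inv, inv_mul_le_iff₀ hst, ← dist_eq_norm, ← dist_eq_norm,
    mul_comm]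
  exact hφ.dist_le_mul s hs.1 t ht

theorem abs_sub_le_integral_indicator {h : ℝ → ℝ} {C : ℝ≥0} (hh : LipschitzWith C h) {K : Set ℝ}
    (hK : IsCompact K) {b : ℝ} (hb : 0 ≤ b) (hbK : ∀ᵐ t, t ∈ K → |deriv h t| ≤ b) {ω a c : ℝ}
    (hac : a ≤ c) (hsub : Set.Ioc a c ⊆ Metric.cthickening ω K) :
    |h c - h a| ≤ b * (c - a) +
      C * ∫ t in a..c, (Metric.cthickening ω K \ K).indicator (fun _ => (1 : ℝ)) t := by
  have hB : MeasurableSet (Metric.cthickening ω K \ K) :=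
    Metric.isClosed_cthickening.measurableSet.diff hK.measurableSet
  have hint : IntervalIntegrable
      ((Metric.cthickening ω K \ K).indicator (fun _ => (1 : ℝ))) volume a c :=
    ⟨(intervalIntegrable_const (c := (1 : ℝ))).1.indicator hB,
      (intervalIntegrable_const (c := (1 : ℝ))).2.indicator hB⟩
  rw [← (hh.lipschitzOnWith
      (s := Set.uIcc a c)).absolutelyContinuousOnInterval.integral_deriv_eq_sub, ← Real.norm_eq_abs]
  calc _ ≤ ∫ t in a..c, (b + C * (Metric.cthickening ω K \ K).indicator (fun _ => (1 : ℝ)) t) := by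
        refine intervalIntegral.norm_integral_le_of_norm_le hac ?_
          (intervalIntegrable_const.add (hint.const_mul _))
        filter_upwards [hbK] with t ht htI
        by_cases htK : t ∈ K
        · simpa [htK] using ht htK
        · have : t ∈ Metric.cthickening ω K \ K := ⟨hsub htI, htK⟩
          rw [Set.indicator_of_mem this, mul_one]
          exact (norm_deriv_le_of_lipschitz hh).trans (le_add_of_nonneg_left hb)
    _ = _ := by
        rw [intervalIntegral.integral_add intervalIntegrable_const (hint.const_mul _),
          intervalIntegral.integral_const, intervalIntegral.integral_const_mul, smul_eq_mul,
          mul_comm b]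

/-- Along an `L`-Lipschitz fragment in `S`, the function `T ∘ F` has slope at most
`(1 - θ) ‖T‖ Lip(F) L` almost everywhere, provided fragments in the direction of the cone are null. -/
theorem ae_abs_deriv_le_of_null_fragments {X V : Type*} [MetricSpace X] [MeasurableSpace X]
    [BorelSpace X] [NormedAddCommGroup V] [NormedSpace ℝ V] [FiniteDimensional ℝ V] {S : Set X}
    {F : X → V} {LF : ℝ≥0} (hF : LipschitzWith LF F) {W : Submodule ℝ V} {θ : ℝ} (hθ : θ ≤ 1)
    (hnull : ∀ (K : Set ℝ) (γ : ℝ → X) (Lγ : ℝ≥0),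
      K ⊆ Set.Icc 0 1 → IsCompact K → K.Nonempty → LipschitzOnWith Lγ γ K →
      InFDirection F (conicalComplement W θ) γ K → μH[1] (γ '' K ∩ S) = 0)
    {T : V →L[ℝ] ℝ} (hT : ∀ w ∈ W, T w = 0) {K : Set ℝ} (hK : IsCompact K)
    (hK01 : K ⊆ Set.Icc 0 1) {γ : ℝ → X} {L : ℝ≥0} (hγ : LipschitzOnWith L γ K)
    (hγS : Set.MapsTo γ K S) {h : ℝ → ℝ} (hh : ∀ t ∈ K, h t = T (F (γ t))) :
    ∀ᵐ t, t ∈ K → |deriv h t| ≤ (1 - θ) * (‖T‖ * LF) * L := by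
  set b : ℝ := (1 - θ) * (‖T‖ * LF) * L with hbdef
  have hb : 0 ≤ b := by have := sub_nonneg.2 hθ; positivity
  have hAmeas : MeasurableSet {t | t ∈ K ∧ b < |deriv h t|} :=
    hK.measurableSet.inter (measurableSet_lt measurable_const (measurable_deriv h).abs)
  suffices hA : volume {t | t ∈ K ∧ b < |deriv h t|} = 0 by
    rw [ae_iff]
    convert hA using 3 with t
    simp
  by_contra hpos
  obtain ⟨K₀, hK₀A, hK₀, hK₀pos⟩ := hAmeas.exists_lt_isCompact (pos_iff_ne_zero.2 hpos)
  obtain ⟨N, P, hN, hP, hNP⟩ := exists_countable_union_perfect_of_isClosed hK₀.isClosed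
  have hPK₀ : P ⊆ K₀ := hNP ▸ Set.subset_union_right
  have hPK : P ⊆ K := fun t ht => (hK₀A (hPK₀ ht)).1
  have hPpos : volume P ≠ 0 := fun h0 => hK₀pos.ne' <| by
    rw [hNP]; exact measure_union_null (hN.measure_zero _) h0
  have hderiv : ∀ t ∈ P, deriv h t ≠ 0 := fun t ht h0 => by
    have := (hK₀A (hPK₀ ht)).2
    rw [h0, abs_zero] at this
    exact this.not_ge hb
  have hlip : LipschitzOnWith (LF * L) (F ∘ γ) P := hF.comp_lipschitzOnWith (hγ.mono hPK)
  have hdir : InFDirection F (conicalComplement W θ) γ P := by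
    unfold InFDirection
    rw [hausdorffMeasure_real, ae_restrict_iff' hP.closed.measurableSet]
    filter_upwards [hlip.ae_differentiableWithinAt_of_mem (μ := volume)] with t ht htP
    have hacc := hP.acc t htP
    have : (𝓝[P \ {t}] t).NeBot := accPt_principal_iff_nhdsWithin.1 hacc
    obtain ⟨v, hv⟩ : ∃ v, HasDerivWithinAt (F ∘ γ) v P t := ⟨_, (ht htP).hasDerivWithinAt⟩
    have hTv : T v = deriv h t := by
      have h1 : HasDerivWithinAt h (deriv h t) P t :=
        (differentiableAt_of_deriv_ne_zero (hderiv t htP)).hasDerivAt.hasDerivWithinAt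
      have h2 : HasDerivWithinAt h (T v) P t :=
        (T.hasFDerivAt.comp_hasDerivWithinAt t hv).congr (fun s hs => hh s (hPK hs))
          (hh t (hPK htP))
      exact tendsto_nhds_unique (hasDerivWithinAt_iff_tendsto_slope.1 h2)
        (hasDerivWithinAt_iff_tendsto_slope.1 h1)
    have hvn : ‖v‖ ≤ LF * L := by
      simpa using norm_le_of_hasDerivWithinAt_of_accPt hlip hv htP hacc
    have hlt : b < |T v| := hTv ▸ (hK₀A (hPK₀ htP)).2
    refine ⟨v, hv, ?_, fun h0 => hderiv t htP (by rw [← hTv, h0, map_zero])⟩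
    have hdist := abs_apply_le_norm_mul_infDist hT v
    have hTpos : 0 < ‖T‖ := (norm_nonneg T).lt_of_ne' fun h0 => by
      rw [h0, zero_mul] at hdist
      exact (hb.trans_lt hlt).not_ge hdist
    refine le_of_mul_le_mul_left (le_trans ?_ (hlt.le.trans hdist)) hTpos
    calc ‖T‖ * ((1 - θ) * ‖v‖) ≤ ‖T‖ * ((1 - θ) * (LF * L)) := by
          have := sub_nonneg.2 hθ; gcongr
      _ = b := by rw [hbdef]; ring
  have hPne : P.Nonempty := nonempty_of_measure_ne_zero hPpos
  have hPcpt : IsCompact P := hK.of_isClosed_subset hP.closed hPK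
  have hzero := hnull P γ L (hPK.trans hK01) hPcpt hPne (hγ.mono hPK) hdir
  rw [Set.inter_eq_left.2 (Set.image_subset_iff.2 fun t ht => hγS (hPK ht))] at hzero
  refine hPpos (volume_eq_zero_of_image_null hderiv ?_)
  have himage : h '' P = (T ∘ F) '' (γ '' P) := by
    rw [Set.image_image]
    exact Set.image_congr fun t ht => hh t (hPK ht)
  rw [himage, ← hausdorffMeasure_real, ← nonpos_iff_eq_zero]
  refine ((T.lipschitz.comp hF).hausdorffMeasure_image_le zero_le_one _).trans ?_
  rw [hzero, mul_zero]

/-- Graphs of uniformly Lipschitz discrete fragments subconverge to a Lipschitz fragment. -/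
theorem exists_limit_fragment {Y : Type*} [MetricSpace Y] [CompactSpace Y] (L : ℝ≥0)
    (G : ℕ → Set (unitInterval × Y)) (hfin : ∀ n, (G n).Finite) (hne : ∀ n, (G n).Nonempty)
    (hlip : ∀ n, ∀ p ∈ G n, ∀ q ∈ G n, dist p.2 q.2 ≤ L * dist p.1 q.1) :
    ∃ (K : Set ℝ) (γ : ℝ → Y), IsCompact K ∧ K ⊆ Set.Icc 0 1 ∧ LipschitzOnWith L γ K ∧
      ∀ τ > 0, ∀ N, ∃ n ≥ N, ∀ p ∈ G n, ∃ s ∈ K, |(p.1 : ℝ) - s| < τ ∧ dist p.2 (γ s) < τ := by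
  classical
  let H : ℕ → TopologicalSpace.NonemptyCompacts (unitInterval × Y) := fun n =>
    ⟨⟨G n, (hfin n).isCompact⟩, hne n⟩
  obtain ⟨G', φ, hφ, hG'⟩ := CompactSpace.tendsto_subseq H
  have hclose : ∀ τ > 0, ∀ N, ∃ n ≥ N, (∀ p ∈ G n, ∃ q ∈ (G' : Set (unitInterval × Y)),
      dist p q < τ) ∧ ∀ q ∈ (G' : Set (unitInterval × Y)), ∃ p ∈ G n, dist p q < τ := by
    intro τ hτ N
    obtain ⟨k, hk, hkN⟩ := ((Metric.tendsto_nhds.1 hG' τ hτ).and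
      (Filter.eventually_ge_atTop N)).exists
    have hedist : Metric.hausdorffEDist (G (φ k)) (G' : Set (unitInterval × Y)) ≠ ⊤ :=
      Metric.hausdorffEDist_ne_top_of_nonempty_of_bounded (hne _) G'.nonempty
        (hfin _).isBounded G'.isCompact.isBounded
    rw [Metric.NonemptyCompacts.dist_eq] at hk
    exact ⟨φ k, hkN.trans (hφ.id_le k),
      fun p hp => Metric.exists_dist_lt_of_hausdorffDist_lt hp hk hedist,
      fun q hq => Metric.exists_dist_lt_of_hausdorffDist_lt' hq hk hedist⟩
  have hG'lip : ∀ p ∈ (G' : Set (unitInterval × Y)), ∀ q ∈ (G' : Set (unitInterval × Y)),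
      dist p.2 q.2 ≤ L * dist p.1 q.1 := by
    intro p hp q hq
    refine le_of_forall_pos_le_add fun e he => ?_
    have hτ : 0 < e / (2 + 2 * L) := by positivity
    obtain ⟨n, -, -, hn⟩ := hclose _ hτ 0
    obtain ⟨p', hp', hpp⟩ := hn p hp
    obtain ⟨q', hq', hqq⟩ := hn q hq
    set τ := e / (2 + 2 * L)
    have hτe : 2 * τ + L * (2 * τ) = e := by
      simp only [τ]; field_simp
    rw [Prod.dist_eq, max_lt_iff] at hpp hqq
    have h1 : dist p.2 q.2 ≤ dist p'.2 p.2 + dist p'.2 q'.2 + dist q'.2 q.2 := by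
      simpa [dist_comm p.2] using dist_triangle4 p.2 p'.2 q'.2 q.2
    have h2 : dist p'.1 q'.1 ≤ dist p'.1 p.1 + dist p.1 q.1 + dist q'.1 q.1 := by
      simpa [dist_comm q.1] using dist_triangle4 p'.1 p.1 q.1 q'.1
    have h3 := hlip n p' hp' q' hq'
    have h4 : (L : ℝ) * dist p'.1 q'.1 ≤ L * (dist p.1 q.1 + 2 * τ) := by
      gcongr; linarith
    linarith
  let K : Set ℝ := (fun p : unitInterval × Y => (p.1 : ℝ)) '' (G' : Set (unitInterval × Y))
  have hsel : ∀ t : ℝ, ∃ y : Y, t ∈ K →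
      ∃ p ∈ (G' : Set (unitInterval × Y)), (p.1 : ℝ) = t ∧ p.2 = y := by
    intro t
    by_cases ht : t ∈ K
    · obtain ⟨p, hp, hpt⟩ := ht
      exact ⟨p.2, fun _ => ⟨p, hp, hpt, rfl⟩⟩
    · exact ⟨(hne 0).some.2, fun h => (ht h).elim⟩
  choose γ hγ using hsel
  refine ⟨K, γ, G'.isCompact.image (by fun_prop), ?_, ?_, ?_⟩
  · rintro _ ⟨p, -, rfl⟩
    exact p.1.2
  · refine LipschitzOnWith.of_dist_le_mul fun s hs t ht => ?_
    obtain ⟨p, hp, rfl, hpγ⟩ := hγ s hs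
    obtain ⟨q, hq, rfl, hqγ⟩ := hγ t ht
    rw [← hpγ, ← hqγ]
    exact hG'lip p hp q hq
  · intro τ hτ N
    obtain ⟨n, hn, hGn, -⟩ := hclose τ hτ N
    refine ⟨n, hn, fun p hp => ?_⟩
    obtain ⟨q, hq, hpq⟩ := hGn p hp
    rw [Prod.dist_eq, max_lt_iff] at hpq
    have hqK : (q.1 : ℝ) ∈ K := ⟨q, hq, rfl⟩
    obtain ⟨q', hq', hqq', hq'γ⟩ := hγ _ hqK
    have hq2 : q'.2 = q.2 := by
      have := hG'lip q' hq' q hq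
      rw [Subtype.ext hqq', dist_self, mul_zero] at this
      exact dist_le_zero.1 this
    refine ⟨q.1, hqK, ?_, ?_⟩
    · simpa [Subtype.dist_eq, Real.dist_eq] using hpq.1
    · rw [← hq'γ, hq2]
      exact hpq.2

/-- The cost of a jump from `x` to `y`: jumps of length at most `r` pay only `κ` times their length,
longer jumps pay the increment of `f` in addition. -/
noncomputable def jumpCost {Y : Type*} [MetricSpace Y] (f : Y → ℝ) (κ r : ℝ) (x y : Y) : ℝ :=
  κ * dist x y + if dist x y ≤ r then 0 else |f x - f y|

theorem mul_dist_le_jumpCost {Y : Type*} [MetricSpace Y] (f : Y → ℝ) (κ r : ℝ) (x y : Y) :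
    κ * dist x y ≤ jumpCost f κ r x y := by
  unfold jumpCost
  split_ifs <;> simp

theorem jumpCost_le {Y : Type*} [MetricSpace Y] (f : Y → ℝ) (κ r : ℝ) (x y : Y) :
    jumpCost f κ r x y ≤ |f x - f y| + κ * dist x y := by
  unfold jumpCost
  split_ifs <;> simp [add_comm]

theorem jumpCost_eq_of_dist_le {Y : Type*} [MetricSpace Y] (f : Y → ℝ) {κ r : ℝ} {x y : Y}
    (h : dist x y ≤ r) : jumpCost f κ r x y = κ * dist x y := by
  simp [jumpCost, h]

theorem jumpCost_eq_of_lt_dist {Y : Type*} [MetricSpace Y] (f : Y → ℝ) {κ r : ℝ} {x y : Y}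
    (h : r < dist x y) : jumpCost f κ r x y = κ * dist x y + |f x - f y| := by
  simp [jumpCost, h.not_ge]

theorem jumpCost_comm {Y : Type*} [MetricSpace Y] (f : Y → ℝ) (κ r : ℝ) (x y : Y) :
    jumpCost f κ r x y = jumpCost f κ r y x := by
  simp only [jumpCost, dist_comm x y, abs_sub_comm (f x)]

theorem exists_volume_cthickening_diff_lt {K : Set ℝ} (hK : IsCompact K) {e : ℝ} (he : 0 < e) :
    ∃ ω > 0, volume.real (Metric.cthickening ω K \ K) < e := by
  have hlt : volume K < volume K + ENNReal.ofReal e :=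
    ENNReal.lt_add_right hK.measure_lt_top.ne (ENNReal.ofReal_pos.2 he).ne'
  have hev := (tendsto_measure_cthickening_of_isCompact (μ := volume) hK).eventually_lt_const hlt
  obtain ⟨ω, hω, hωpos⟩ :=
    ((hev.filter_mono nhdsWithin_le_nhds).and (self_mem_nhdsWithin (s := Set.Ioi (0 : ℝ)))).exists
  refine ⟨ω, hωpos, ?_⟩
  have hKω : K ⊆ Metric.cthickening ω K := Metric.self_subset_cthickening K
  rw [measureReal_def, measure_sdiff hKω hK.measurableSet.nullMeasurableSet hK.measure_lt_top.ne]
  refine ENNReal.toReal_lt_of_lt_ofReal ?_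
  exact ENNReal.sub_lt_of_lt_add (measure_mono hKω) (by rwa [add_comm])

theorem sub_le_sum_jumpCost_of_close {Y : Type*} [MetricSpace Y] {f : Y → ℝ} {κ r ω e : ℝ}
    {C L : ℝ≥0} {h : ℝ → ℝ} (hκ : 0 ≤ κ) (hh : LipschitzWith C h) {K : Set ℝ} (hK : IsCompact K)
    (hbK : ∀ᵐ t, t ∈ K → |deriv h t| ≤ κ * L) (hω : 0 < ω) (hr : r ≤ L * (ω / 2)) (n : ℕ)
    (x : ℕ → Y) (t : ℕ → ℝ) (ht0 : t 0 = 0) (htn : t n ≤ 1)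
    (hxt : ∀ i, dist (x i) (x (i + 1)) = L * (t (i + 1) - t i)) (hmono : Monotone t)
    (hL : 0 < L) (hclose : ∀ i ≤ n, |h (t i) - f (x i)| ≤ e)
    (hnear : ∀ i ≤ n, ∃ s ∈ K, |t i - s| < ω / 2) :
    f (x 0) ≤ f (x n) + ∑ i ∈ Finset.range n, jumpCost f κ r (x i) (x (i + 1)) +
      C * volume.real (Metric.cthickening ω K \ K) + 2 * e * (1 + 2 / ω) := by
  set B := Metric.cthickening ω K \ K with hBdef
  have hB : MeasurableSet B := Metric.isClosed_cthickening.measurableSet.diff hK.measurableSet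
  have hBfin : volume B ≠ ⊤ :=
    ((measure_mono Set.sdiff_subset).trans_lt hK.cthickening.measure_lt_top).ne
  have he : 0 ≤ e := (abs_nonneg _).trans (hclose 0 n.zero_le)
  have hint : ∀ a c, IntervalIntegrable (B.indicator (fun _ => (1 : ℝ))) volume a c := fun a c =>
    ⟨(intervalIntegrable_const (c := (1 : ℝ))).1.indicator hB,
      (intervalIntegrable_const (c := (1 : ℝ))).2.indicator hB⟩
  have hnonneg : ∀ i, 0 ≤ ∫ s in (t i)..(t (i + 1)), B.indicator (fun _ => (1 : ℝ)) s := fun i =>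
    intervalIntegral.integral_nonneg (hmono i.le_succ)
      fun s _ => Set.indicator_nonneg (fun _ _ => zero_le_one) s
  have hstep : ∀ i ∈ Finset.range n, |h (t (i + 1)) - h (t i)| ≤ jumpCost f κ r (x i) (x (i + 1)) +
      C * (∫ s in (t i)..(t (i + 1)), B.indicator (fun _ => (1 : ℝ)) s) +
      2 * e * (2 / ω) * (t (i + 1) - t i) := by
    intro i hi
    have hin : i + 1 ≤ n := Finset.mem_range.1 hi
    have hti : 0 ≤ t (i + 1) - t i := sub_nonneg.2 (hmono i.le_succ)
    rcases le_or_gt (t (i + 1) - t i) (ω / 2) with hsmall | hbig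
    · have hsub : Set.Ioc (t i) (t (i + 1)) ⊆ Metric.cthickening ω K := by
        intro s hs
        obtain ⟨u, hu, hut⟩ := hnear (i + 1) hin
        refine Metric.mem_cthickening_of_dist_le s u ω K hu ?_
        rw [Real.dist_eq, abs_le]
        rw [abs_lt] at hut
        constructor <;> linarith [hs.1, hs.2]
      have h1 := abs_sub_le_integral_indicator hh hK (by positivity) hbK (hmono i.le_succ) hsub
      have h2 := mul_dist_le_jumpCost f κ r (x i) (x (i + 1))
      rw [hxt i, ← mul_assoc] at h2
      have h3 : 0 ≤ 2 * e * (2 / ω) * (t (i + 1) - t i) := by positivity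
      linarith
    · have hlt : r < dist (x i) (x (i + 1)) := by
        rw [hxt i]
        exact hr.trans_lt (mul_lt_mul_of_pos_left hbig (by exact_mod_cast hL))
      rw [jumpCost_eq_of_lt_dist f hlt]
      have h1 := abs_le.1 (hclose i (by omega))
      have h2 := abs_le.1 (hclose (i + 1) hin)
      have h3 : |h (t (i + 1)) - h (t i)| ≤ |f (x i) - f (x (i + 1))| + 2 * e := by
        have h4 := le_abs_self (f (x i) - f (x (i + 1)))
        have h5 := neg_abs_le (f (x i) - f (x (i + 1)))
        rw [abs_le]
        constructor <;> linarith
      have h4 : 1 ≤ 2 / ω * (t (i + 1) - t i) := by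
        rw [div_mul_eq_mul_div, one_le_div hω]
        linarith
      have h5 : 2 * e ≤ 2 * e * (2 / ω) * (t (i + 1) - t i) := by
        rw [mul_assoc]
        exact le_mul_of_one_le_right (by positivity) h4
      have h6 : 0 ≤ κ * dist (x i) (x (i + 1)) := by positivity
      have h7 := mul_nonneg C.coe_nonneg (hnonneg i)
      linarith
  have hsum := Finset.sum_le_sum hstep
  rw [Finset.sum_add_distrib, Finset.sum_add_distrib, ← Finset.mul_sum, ← Finset.mul_sum,
    Finset.sum_range_sub, intervalIntegral.sum_integral_adjacent_intervals
      (fun k _ => hint (t k) (t (k + 1)))] at hsum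
  have htele : |h (t n) - h (t 0)| ≤ ∑ i ∈ Finset.range n, |h (t (i + 1)) - h (t i)| := by
    rw [← Finset.sum_range_sub (fun i => h (t i))]
    exact Finset.abs_sum_le_sum_abs _ _
  have hvol : ∫ s in (t 0)..(t n), B.indicator (fun _ => (1 : ℝ)) s ≤ volume.real B := by
    rw [intervalIntegral.integral_of_le (hmono n.zero_le), integral_indicator hB,
      setIntegral_const, smul_eq_mul, mul_one, measureReal_restrict_apply hB]
    exact measureReal_mono Set.inter_subset_left hBfin
  have hCvol := mul_le_mul_of_nonneg_left hvol C.coe_nonneg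
  have hlast : 2 * e * (2 / ω) * (t n - t 0) ≤ 2 * e * (2 / ω) := by
    refine mul_le_of_le_one_right (by positivity) ?_
    linarith
  have h1 := abs_le.1 (hclose 0 n.zero_le)
  have h2 := abs_le.1 (hclose n le_rfl)
  have h3 := neg_abs_le (h (t n) - h (t 0))
  linarith

/-- If `f` has slope at most `κ` along all fragments of a compact space, then for a small enough
scale `r` the increment of `f` along any chain is almost bounded by the total jump cost. -/
theorem exists_scale_sub_le_sum_jumpCost {Y : Type*} [MetricSpace Y] [CompactSpace Y] {f : Y → ℝ}
    {M : ℝ≥0} (hf : LipschitzWith M f) {κ : ℝ} (hκ : 0 < κ)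
    (hderiv : ∀ (K : Set ℝ) (γ : ℝ → Y) (L : ℝ≥0) (h : ℝ → ℝ), IsCompact K → K ⊆ Set.Icc 0 1 →
      LipschitzOnWith L γ K → (∀ t ∈ K, h t = f (γ t)) → ∀ᵐ t, t ∈ K → |deriv h t| ≤ κ * L)
    {ε : ℝ} (hε : 0 < ε) :
    ∃ r > 0, ∀ (n : ℕ) (x : ℕ → Y),
      f (x 0) ≤ f (x n) + ∑ i ∈ Finset.range n, jumpCost f κ r (x i) (x (i + 1)) + ε := by
  by_contra! H
  choose n x hx using fun k : ℕ => H (1 / (k + 1)) (by positivity)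
  obtain ⟨C, hC⟩ := isCompact_univ.exists_bound_of_continuousOn hf.continuous.continuousOn
  have hC0 : 0 ≤ C := (norm_nonneg _).trans (hC (x 0 0) (Set.mem_univ _))
  set L : ℝ≥0 := ⟨2 * C / κ + 1, by positivity⟩
  have hL : (0 : ℝ) < L := by change 0 < 2 * C / κ + 1; positivity
  have hκL : 2 * C ≤ κ * L := by
    change 2 * C ≤ κ * (2 * C / κ + 1)
    rw [mul_add, mul_div_cancel₀ _ hκ.ne']
    linarith
  set t : ℕ → ℕ → ℝ := fun k i => (∑ j ∈ Finset.range i, dist (x k j) (x k (j + 1))) / L with ht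
  have hxt : ∀ k i, dist (x k i) (x k (i + 1)) = L * (t k (i + 1) - t k i) := by
    intro k i
    simp only [ht, Finset.sum_range_succ]
    field_simp
    ring
  have hmono : ∀ k, Monotone (t k) := fun k => monotone_nat_of_le_succ fun i => by
    have h1 : 0 ≤ L * (t k (i + 1) - t k i) := hxt k i ▸ dist_nonneg
    exact sub_nonneg.1 (nonneg_of_mul_nonneg_right h1 hL)
  have ht0 : ∀ k, t k 0 = 0 := fun k => by simp [ht]
  have htn : ∀ k, t k (n k) ≤ 1 := fun k => by
    have h1 : κ * ∑ i ∈ Finset.range (n k), dist (x k i) (x k (i + 1)) ≤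
        ∑ i ∈ Finset.range (n k), jumpCost f κ (1 / (k + 1)) (x k i) (x k (i + 1)) := by
      rw [Finset.mul_sum]
      exact Finset.sum_le_sum fun i _ => mul_dist_le_jumpCost _ _ _ _ _
    have h2 := abs_le.1 (hC (x k 0) (Set.mem_univ _))
    have h3 := abs_le.1 (hC (x k (n k)) (Set.mem_univ _))
    refine (div_le_one hL).2 (le_of_mul_le_mul_left (le_trans ?_ hκL) hκ)
    linarith [hx k]
  have htmem : ∀ k, ∀ i ≤ n k, t k i ∈ Set.Icc (0 : ℝ) 1 := fun k i hi =>
    ⟨ht0 k ▸ hmono k i.zero_le, (hmono k hi).trans (htn k)⟩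
  have hdist : ∀ k i j, i ≤ j → dist (x k i) (x k j) ≤ L * (t k j - t k i) := by
    intro k i j hij
    refine (dist_le_Ico_sum_dist (x k) hij).trans_eq ?_
    simp only [hxt, ← Finset.mul_sum]
    rw [Finset.sum_Ico_sub (t k) hij]
  let G : ℕ → Set (unitInterval × Y) := fun k =>
    (fun i => (Set.projIcc 0 1 zero_le_one (t k i), x k i)) '' Set.Iic (n k)
  obtain ⟨K, γ, hK, hK01, hγ, hclose⟩ := exists_limit_fragment L G
    (fun k => (Set.finite_Iic _).image _) (fun k => Set.nonempty_Iic.image _) (by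
      rintro k _ ⟨i, hi, rfl⟩ _ ⟨j, hj, rfl⟩
      simp only [Subtype.dist_eq, Set.projIcc_of_mem zero_le_one (htmem k i hi),
        Set.projIcc_of_mem zero_le_one (htmem k j hj)]
      rcases le_total i j with hij | hij
      · rw [dist_comm (t k i), Real.dist_eq, abs_of_nonneg (sub_nonneg.2 (hmono k hij))]
        exact hdist k i j hij
      · rw [dist_comm, Real.dist_eq, abs_of_nonneg (sub_nonneg.2 (hmono k hij))]
        exact hdist k j i hij)
  obtain ⟨h, hh, hhγ⟩ := (hf.comp_lipschitzOnWith hγ).extend_real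
  have hbK := hderiv K γ L h hK hK01 hγ (fun t ht => (hhγ ht).symm)
  obtain ⟨ω, hω, hωK⟩ := exists_volume_cthickening_diff_lt hK
    (e := ε / (2 * (M * L + 1))) (by positivity)
  set A : ℝ := 4 * (M * L + M + 1) * (1 + 2 / ω) with hA
  have hApos : 0 < A := by positivity
  obtain ⟨k₀, hk₀⟩ := exists_nat_one_div_lt (K := ℝ) (show 0 < L * (ω / 2) by positivity)
  obtain ⟨k, hk, hkK⟩ := hclose (min (ω / 2) (ε / A)) (by positivity) k₀
  have hr : 1 / ((k : ℝ) + 1) ≤ L * (ω / 2) := by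
    refine le_trans ?_ hk₀.le
    gcongr
  have hpt : ∀ i ≤ n k, ∃ s ∈ K, |t k i - s| < min (ω / 2) (ε / A) ∧
      dist (x k i) (γ s) < min (ω / 2) (ε / A) := by
    intro i hi
    have := hkK _ ⟨i, hi, rfl⟩
    simpa only [Set.projIcc_of_mem zero_le_one (htmem k i hi)] using this
  have hfinal := sub_le_sum_jumpCost_of_close (e := (M * L + M) * (ε / A)) hκ.le hh hK hbK hω hr
    (n k) (x k) (t k) (ht0 k) (htn k) (hxt k) (hmono k) (by exact_mod_cast hL) (by
      intro i hi
      obtain ⟨s, hs, hts, hxs⟩ := hpt i hi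
      have h1 : |h (t k i) - h s| ≤ (M * L : ℝ≥0) * |t k i - s| := hh.dist_le_mul _ _
      have h2 : |f (γ s) - f (x k i)| ≤ M * dist (γ s) (x k i) := hf.dist_le_mul _ _
      have h3 : h s = f (γ s) := (hhγ hs).symm
      have hts' := hts.le.trans (min_le_right _ _)
      have hxs' := hxs.le.trans (min_le_right _ _)
      rw [dist_comm] at h2
      calc |h (t k i) - f (x k i)| ≤ |h (t k i) - h s| + |f (γ s) - f (x k i)| := by
            rw [h3]; exact abs_sub_le _ _ _
        _ ≤ (M * L : ℝ≥0) * (ε / A) + M * (ε / A) := by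
            refine add_le_add (h1.trans ?_) (h2.trans ?_) <;> gcongr
        _ = _ := by push_cast; ring)
    (fun i hi => (hpt i hi).imp fun s hs => ⟨hs.1, hs.2.1.trans_le (min_le_left _ _)⟩)
  have hfirst : ((M * L : ℝ≥0) : ℝ) * volume.real (Metric.cthickening ω K \ K) ≤ ε / 2 := by
    calc _ ≤ (M * L + 1) * (ε / (2 * (M * L + 1))) := by
          push_cast
          gcongr
          linarith
      _ = ε / 2 := by field_simp
  have hsecond : 2 * ((M * L + M) * (ε / A)) * (1 + 2 / ω) ≤ ε / 2 := by
    calc _ ≤ 2 * ((M * L + M + 1) * (ε / A)) * (1 + 2 / ω) := by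
          gcongr 2 * (?_ * _) * _
          linarith
      _ = (A * (ε / A)) / 2 := by rw [hA]; ring
      _ = ε / 2 := by rw [mul_div_cancel₀ _ hApos.ne']
  linarith [hx k]

/-- The infimal chain cost approximates `f` and is `κ`-Lipschitz at scales below `r`. -/
theorem exists_close_locally_lipschitz {Y : Type*} [MetricSpace Y] {f : Y → ℝ} {κ r ε : ℝ}
    (hr : ∀ (n : ℕ) (x : ℕ → Y),
      f (x 0) ≤ f (x n) + ∑ i ∈ Finset.range n, jumpCost f κ r (x i) (x (i + 1)) + ε) :
    ∃ f₁ : Y → ℝ, (∀ y z, |f₁ y - f₁ z| ≤ jumpCost f κ r y z) ∧ ∀ y, |f y - f₁ y| ≤ ε := by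
  let cost : ℕ × (ℕ → Y) → ℝ := fun c =>
    f (c.2 c.1) + ∑ i ∈ Finset.range c.1, jumpCost f κ r (c.2 i) (c.2 (i + 1))
  let chains : Y → Set (ℕ × (ℕ → Y)) := fun y => {c | c.2 0 = y}
  have hlow : ∀ y, ∀ c ∈ chains y, f y - ε ≤ cost c := by
    rintro y ⟨n, x⟩ (rfl : x 0 = y)
    have := hr n x
    simp only [cost]
    linarith
  have hbdd : ∀ y, BddBelow (cost '' chains y) := fun y =>
    ⟨f y - ε, by rintro _ ⟨c, hc, rfl⟩; exact hlow y c hc⟩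
  have hconst : ∀ y, ((0 : ℕ), fun _ : ℕ => y) ∈ chains y := fun y => rfl
  have hne : ∀ y, (cost '' chains y).Nonempty := fun y => ⟨_, _, hconst y, rfl⟩
  have hstep : ∀ y z, sInf (cost '' chains y) ≤ sInf (cost '' chains z) + jumpCost f κ r y z := by
    intro y z
    rw [← sub_le_iff_le_add]
    refine le_csInf (hne z) ?_
    rintro _ ⟨⟨n, x⟩, (rfl : x 0 = z), rfl⟩
    rw [sub_le_iff_le_add]
    let x' : ℕ → Y := fun i => Nat.casesOn i y x
    have hx' : (n + 1, x') ∈ chains y := show x' 0 = y from rfl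
    refine (csInf_le (hbdd y) ⟨_, hx', rfl⟩).trans_eq ?_
    simp only [cost, Finset.sum_range_succ', ← add_assoc]
    rfl
  refine ⟨fun y => sInf (cost '' chains y), fun y z => ?_, fun y => ?_⟩
  · have h1 := hstep y z
    have h2 := hstep z y
    rw [jumpCost_comm] at h2
    rw [abs_le]
    constructor <;> linarith
  · have h1 : sInf (cost '' chains y) ≤ f y := by
      simpa [cost] using csInf_le (hbdd y) ⟨_, hconst y, rfl⟩
    have h2 : f y - ε ≤ sInf (cost '' chains y) := le_csInf (hne y) (by
      rintro _ ⟨c, hc, rfl⟩; exact hlow y c hc)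
    rw [abs_le]
    constructor <;> linarith

theorem isOpen_setOf_lt_fract {q : ℝ} (hq : 0 ≤ q) : IsOpen {u : ℝ | q < Int.fract u} := by
  have : {u : ℝ | q < Int.fract u} = ⋃ k : ℤ, Set.Ioo (k + q) (k + 1) := by
    ext u
    simp only [Set.mem_ofPred_eq, Set.mem_iUnion, Set.mem_Ioo]
    constructor
    · intro hu
      refine ⟨⌊u⌋, ?_, Int.lt_floor_add_one u⟩
      rw [Int.fract] at hu
      linarith
    · rintro ⟨k, hk1, hk2⟩
      have : ⌊u⌋ = k := Int.floor_eq_iff.2 ⟨by linarith, hk2⟩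
      rw [Int.fract, this]
      linarith
  rw [this]
  exact isOpen_iUnion fun _ => isOpen_Ioo

theorem floor_sub_floor_le_of_fract_le {N u w : ℝ} (hN : 1 ≤ N)
    (hu : Int.fract u ≤ 1 - 1 / N) (hw : Int.fract w ≤ 1 - 1 / N) :
    |(⌊u⌋ : ℝ) - ⌊w⌋| ≤ N * |u - w| := by
  wlog hwu : w ≤ u generalizing u w
  · rw [abs_sub_comm, abs_sub_comm u]
    exact this hw hu (le_of_not_ge hwu)
  have hfloor : ⌊w⌋ ≤ ⌊u⌋ := Int.floor_le_floor hwu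
  rw [abs_of_nonneg (sub_nonneg.2 (by exact_mod_cast hfloor)), abs_of_nonneg (sub_nonneg.2 hwu)]
  rcases hfloor.eq_or_lt with heq | hlt
  · rw [heq, sub_self]
    have := sub_nonneg.2 hwu
    positivity
  have hk : (1 : ℝ) ≤ ⌊u⌋ - ⌊w⌋ := by
    rw [le_sub_iff_add_le, add_comm]
    exact_mod_cast hlt
  have hu0 := Int.floor_le u
  rw [Int.fract] at hw
  have hN0 : 0 < N := by linarith
  have h1 : N * ((⌊u⌋ - ⌊w⌋ : ℝ) - 1 + 1 / N) ≤ N * (u - w) := by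
    gcongr
    linarith
  have h2 : N * ((⌊u⌋ - ⌊w⌋ : ℝ) - 1 + 1 / N) = N * ((⌊u⌋ - ⌊w⌋ : ℝ) - 1) + 1 := by
    field_simp
  nlinarith

theorem abs_floor_sub_floor_le (u w : ℝ) : |(⌊u⌋ : ℝ) - ⌊w⌋| ≤ |u - w| + 1 := by
  have h1 := le_abs_self (u - w)
  have h2 := neg_abs_le (u - w)
  rw [abs_le]
  constructor <;> linarith [Int.floor_le u, Int.lt_floor_add_one u, Int.floor_le w,
    Int.lt_floor_add_one w]

theorem exists_shift_measure_fract_le {Y : Type*} [TopologicalSpace Y] [MeasurableSpace Y]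
    [OpensMeasurableSpace Y] (ν : Measure Y) [IsProbabilityMeasure ν] {u : Y → ℝ}
    (hu : Continuous u) {N : ℕ} (hN : 0 < N) :
    ∃ a ∈ Set.Icc (0 : ℝ) 1, ν {y | 1 - 1 / (N : ℝ) < Int.fract (u y - a)} ≤ (N : ℝ≥0∞)⁻¹ := by
  have hN' : (0 : ℝ) < N := by exact_mod_cast hN
  have hq : 0 ≤ 1 - 1 / (N : ℝ) := by
    rw [sub_nonneg, div_le_one hN']
    exact_mod_cast hN
  let B : ℕ → Set Y := fun j => {y | 1 - 1 / (N : ℝ) < Int.fract (u y - j / N)}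
  have hmeas : ∀ j, MeasurableSet (B j) := fun j =>
    ((isOpen_setOf_lt_fract hq).preimage (hu.sub continuous_const)).measurableSet
  have hdisj : Set.PairwiseDisjoint (Finset.range N : Set ℕ) B := by
    intro i hi j hj hij
    refine Set.disjoint_left.2 fun y hyi hyj => hij ?_
    replace hyi : 1 - 1 / (N : ℝ) < Int.fract (u y - i / N) := hyi
    replace hyj : 1 - 1 / (N : ℝ) < Int.fract (u y - j / N) := hyj
    have hi1 := Int.fract_lt_one (u y - i / N)
    have hj1 := Int.fract_lt_one (u y - j / N)
    rw [Finset.coe_range, Set.mem_Iio] at hi hj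
    set k : ℤ := ⌊u y - j / N⌋ - ⌊u y - i / N⌋ with hk
    have hdiff : (i : ℝ) - j - N * k =
        N * (Int.fract (u y - j / N) - Int.fract (u y - i / N)) := by
      simp only [Int.fract, hk]
      push_cast
      field_simp
      ring
    have habs : |(i : ℝ) - j - N * k| < 1 := by
      rw [hdiff, abs_mul, abs_of_pos hN', ← lt_div_iff₀' hN', abs_lt]
      constructor <;> linarith
    have hzero : (i : ℤ) - j - N * k = 0 := by
      rw [← Int.abs_lt_one_iff]
      exact_mod_cast habs
    have hmod : (i : ℤ) ≡ j [ZMOD N] :=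
      (Int.modEq_iff_dvd.2 ⟨k, by linarith⟩ : (j : ℤ) ≡ i [ZMOD N]).symm
    exact Nat.ModEq.eq_of_lt_of_lt ((Int.natCast_modEq_iff).1 hmod) hi hj
  by_contra! H
  have hlt : ∀ j ∈ Finset.range N, (N : ℝ≥0∞)⁻¹ < ν (B j) := fun j hj =>
    H _ ⟨by positivity, by
      rw [div_le_one hN']
      exact_mod_cast (Finset.mem_range.1 hj).le⟩
  have hsum := ENNReal.sum_lt_sum_of_nonempty (Finset.nonempty_range_iff.2 hN.ne') hlt
  rw [← measure_biUnion_finset hdisj fun j _ => hmeas j, Finset.sum_const, Finset.card_range,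
    nsmul_eq_mul, ENNReal.mul_inv_cancel (by exact_mod_cast hN.ne') (by simp)] at hsum
  exact hsum.not_ge prob_le_one

/-- Rounding `f₁` down to a grid gives a finite-valued function; discarding a set of measure at
most `1 / N` keeps the Lipschitz bound up to a factor `N`. -/
theorem exists_finite_valued_approximation {Y : Type*} [MetricSpace Y] [CompactSpace Y]
    [MeasurableSpace Y] [BorelSpace Y] (ν : Measure Y) [IsProbabilityMeasure ν] {f f₁ : Y → ℝ}
    {κ r ε : ℝ} (hκ : 0 < κ) (hr : 0 < r) (hε : 0 < ε) (hf : Continuous f)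
    (hf₁ : ∀ y z, |f₁ y - f₁ z| ≤ jumpCost f κ r y z) {N : ℕ} (hN : 2 ≤ N) :
    ∃ (g : Y → ℝ) (E : Set Y), IsClosed E ∧ (N : ℝ≥0∞)⁻¹ + ν E ≥ 1 ∧ (g '' E).Finite ∧
      (∀ y, |f₁ y - g y| ≤ ε) ∧
      ∀ y ∈ E, ∀ z ∈ E, |g y - g z| ≤ |f y - f z| + N * κ * dist y z := by
  have hN2 : (2 : ℝ) ≤ N := by exact_mod_cast hN
  have hf₁c : Continuous f₁ := by
    refine continuous_iff_continuousAt.2 fun y => ?_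
    rw [ContinuousAt, tendsto_iff_dist_tendsto_zero]
    have hlim : Filter.Tendsto (fun z => |f z - f y| + κ * dist z y) (𝓝 y) (𝓝 0) := by
      have : Continuous fun z => |f z - f y| + κ * dist z y := by fun_prop
      simpa using this.tendsto y
    exact squeeze_zero (fun _ => dist_nonneg)
      (fun z => (hf₁ z y).trans (jumpCost_le f κ r z y)) hlim
  set s : ℝ := min (ε / 2) (κ * r)
  have hspos : 0 < s := by positivity
  obtain ⟨a, ha, hmeas⟩ := exists_shift_measure_fract_le ν (u := fun y => f₁ y / s)
    (hf₁c.div_const s) (N := N) (by omega)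
  set u : Y → ℝ := fun y => f₁ y / s - a with hu
  have huc : Continuous u := (hf₁c.div_const s).sub continuous_const
  have hsu : ∀ y, f₁ y = s * (u y + a) := fun y => by
    simp only [hu]
    field_simp
    ring
  have hopen : IsOpen {y | 1 - 1 / (N : ℝ) < Int.fract (u y)} := by
    refine (isOpen_setOf_lt_fract ?_).preimage huc
    rw [sub_nonneg, div_le_one (by linarith)]
    linarith
  refine ⟨fun y => s * ⌊u y⌋, {y | 1 - 1 / (N : ℝ) < Int.fract (u y)}ᶜ, hopen.isClosed_compl,
    ?_, ?_, fun y => ?_, fun y hy z hz => ?_⟩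
  · calc (1 : ℝ≥0∞) = ν {y | 1 - 1 / (N : ℝ) < Int.fract (u y)} +
          ν {y | 1 - 1 / (N : ℝ) < Int.fract (u y)}ᶜ := by
          rw [measure_add_measure_compl hopen.measurableSet, measure_univ]
      _ ≤ _ := by gcongr
  · obtain ⟨C, hC⟩ := isCompact_univ.exists_bound_of_continuousOn huc.continuousOn
    refine ((Set.finite_Icc ⌊-C⌋ ⌊C⌋).image fun k : ℤ => s * (k : ℝ)).subset ?_
    rintro _ ⟨y, -, rfl⟩
    have := abs_le.1 (hC y (Set.mem_univ y))
    exact ⟨⌊u y⌋, ⟨Int.floor_le_floor this.1, Int.floor_le_floor this.2⟩, rfl⟩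
  · have hrw : f₁ y - s * ⌊u y⌋ = s * (Int.fract (u y) + a) := by
      rw [hsu y, Int.fract]; ring
    have h1 := Int.fract_nonneg (u y)
    have h2 := (Int.fract_lt_one (u y)).le
    rw [hrw, abs_of_nonneg (mul_nonneg hspos.le (add_nonneg h1 ha.1))]
    calc s * (Int.fract (u y) + a) ≤ ε / 2 * (1 + 1) :=
          mul_le_mul (min_le_left _ _) (add_le_add h2 ha.2) (add_nonneg h1 ha.1) (by positivity)
      _ = ε := by ring
  · have hrw : |s * (⌊u y⌋ : ℝ) - s * ⌊u z⌋| = s * |(⌊u y⌋ : ℝ) - ⌊u z⌋| := by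
      rw [← mul_sub, abs_mul, abs_of_pos hspos]
    have hf₁s : |f₁ y - f₁ z| = s * |u y - u z| := by
      rw [hsu y, hsu z, ← mul_sub, abs_mul, abs_of_pos hspos, add_sub_add_right_eq_sub]
    simp only [hrw]
    rcases le_or_gt (dist y z) r with hle | hlt
    · have h1 := floor_sub_floor_le_of_fract_le (by linarith : (1 : ℝ) ≤ N)
        (not_lt.1 hy) (not_lt.1 hz)
      have h2 := hf₁ y z
      rw [jumpCost_eq_of_dist_le f hle, hf₁s] at h2
      calc s * |(⌊u y⌋ : ℝ) - ⌊u z⌋| ≤ s * (N * |u y - u z|) := by gcongr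
        _ = N * (s * |u y - u z|) := by ring
        _ ≤ N * (κ * dist y z) := by gcongr
        _ ≤ |f y - f z| + N * κ * dist y z := by
            rw [← mul_assoc]
            exact le_add_of_nonneg_left (abs_nonneg _)
    · have h1 := hf₁ y z
      rw [jumpCost_eq_of_lt_dist f hlt, hf₁s] at h1
      have h2 : s ≤ κ * dist y z := (min_le_right _ _).trans (by gcongr)
      have h3 : 2 * (κ * dist y z) ≤ N * (κ * dist y z) := by gcongr
      have h4 := mul_le_mul_of_nonneg_left (abs_floor_sub_floor_le (u y) (u z)) hspos.le
      linarith

/-- McShane extension for the pseudometric `|f y - f z| + κ * dist y z`, truncated to stay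
close to `f`. -/
theorem exists_extension_close {X : Type*} [MetricSpace X] {f g₀ : X → ℝ} {κ ε : ℝ} (hκ : 0 ≤ κ)
    (hε : 0 ≤ ε) {E : Set X} (hE : E.Nonempty) (hclose : ∀ x ∈ E, |f x - g₀ x| ≤ ε)
    (hg₀ : ∀ y ∈ E, ∀ z ∈ E, |g₀ y - g₀ z| ≤ |f y - f z| + κ * dist y z) :
    ∃ g : X → ℝ, Set.EqOn g g₀ E ∧ (∀ x, |f x - g x| ≤ ε) ∧
      ∀ y z, |g y - g z| ≤ |f y - f z| + κ * dist y z := by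
  have hEne : Nonempty E := hE.to_subtype
  let Φ : X → E → ℝ := fun x e => g₀ e + (|f x - f e| + κ * dist x e)
  have htri : ∀ y z (e : E), Φ y e ≤ Φ z e + (|f y - f z| + κ * dist y z) := by
    intro y z e
    have h1 := abs_sub_le (f y) (f z) (f e)
    have h2 := mul_le_mul_of_nonneg_left (dist_triangle y z e) hκ
    simp only [Φ]
    linarith
  have hself : ∀ (y : E) (e : E), g₀ y ≤ Φ y e := by
    intro y e
    have := (abs_le.1 (hg₀ y y.2 e e.2)).2
    simp only [Φ]
    linarith
  have hbdd : ∀ x, BddBelow (Set.range (Φ x)) := by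
    intro x
    obtain ⟨y⟩ := hEne
    refine ⟨g₀ y - (|f y - f x| + κ * dist (y : X) x), ?_⟩
    rintro _ ⟨e, rfl⟩
    linarith [htri y x e, hself y e]
  have hstep : ∀ y z, ⨅ e, Φ y e ≤ (⨅ e, Φ z e) + (|f y - f z| + κ * dist y z) := by
    intro y z
    rw [← sub_le_iff_le_add]
    refine le_ciInf fun e => ?_
    linarith [ciInf_le (hbdd y) e, htri y z e]
  let g₁ : X → ℝ := fun x => ⨅ e, Φ x e
  refine ⟨fun x => max (f x - ε) (min (f x + ε) (g₁ x)), fun y hy => ?_, fun x => ?_,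
    fun y z => ?_⟩
  · have h1 : g₁ y = g₀ y := le_antisymm
      ((ciInf_le (hbdd y) ⟨y, hy⟩).trans_eq (by simp [Φ])) (le_ciInf fun e => hself ⟨y, hy⟩ e)
    have h2 := abs_le.1 (hclose y hy)
    simp only [h1]
    rw [min_eq_right (by linarith), max_eq_right (by linarith)]
  · have h1 := le_max_left (f x - ε) (min (f x + ε) (g₁ x))
    have h2 : max (f x - ε) (min (f x + ε) (g₁ x)) ≤ f x + ε :=
      max_le (by linarith) (min_le_left _ _)
    rw [abs_le]
    constructor <;> linarith
  · have hρ : |f y - f z| ≤ |f y - f z| + κ * dist y z :=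
      le_add_of_nonneg_right (by positivity)
    have hg₁ : |g₁ y - g₁ z| ≤ |f y - f z| + κ * dist y z := by
      have h1 := hstep y z
      have h2 := hstep z y
      rw [abs_sub_comm, dist_comm] at h2
      rw [abs_le]
      constructor <;> simp only [g₁] <;> linarith
    refine (abs_max_sub_max_le_max _ _ _ _).trans (max_le (by simpa using hρ) ?_)
    exact (abs_min_sub_min_le_max _ _ _ _).trans (max_le (by simpa using hρ) hg₁)

/-- The main real-valued perturbation theorem: for every `η ∈ (0,1)` and `δ > 0` there is
`θ ∈ (0,1)` such that for any metric space `X`, compact `S ⊆ X`, finite-dimensional normed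
space `V`, Lipschitz `F : X → V`, subspace `W ⊆ V` such that every curve fragment in the
`F`-direction of `E(W,θ)` meets `S` in an `H¹`-null set, and linear `T : V → ℝ` with
`W ⊆ ker T`: for every `ε > 0` and Borel probability measure `μ` on `S` there are `g : X → ℝ`
and compact `E ⊆ S` with the stated Lipschitz-type bound, `ε`-closeness to `T ∘ F`, and
`μ(E) ≥ 1 − η` with `g(E)` finite. -/
theorem stmt_12 (η δ : ℝ) (hη : η ∈ Set.Ioo (0 : ℝ) 1) (hδ : 0 < δ) :
    ∃ θ ∈ Set.Ioo (0 : ℝ) 1,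
      ∀ (X : Type u) (V : Type v) [MetricSpace X] [MeasurableSpace X] [BorelSpace X]
        [NormedAddCommGroup V] [NormedSpace ℝ V] [FiniteDimensional ℝ V]
        (S : Set X), IsCompact S →
        ∀ (F : X → V) (LF : NNReal), LipschitzWith LF F →
          ∀ W : Submodule ℝ V,
            (∀ (K : Set ℝ) (γ : ℝ → X) (Lγ : NNReal),
              K ⊆ Set.Icc 0 1 → IsCompact K → K.Nonempty → LipschitzOnWith Lγ γ K →
              InFDirection F (conicalComplement W θ) γ K →
              μH[1] (γ '' K ∩ S) = 0) →
            ∀ T : V →L[ℝ] ℝ, (∀ v ∈ W, T v = 0) →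
              ∀ ε : ℝ, 0 < ε →
                ∀ μ : Measure X, IsProbabilityMeasure μ → μ Sᶜ = 0 →
                  ∃ (g : X → ℝ) (E : Set X), E ⊆ S ∧ IsCompact E ∧
                    (∀ y z : X,
                      |g y - g z| ≤ |T (F y) - T (F z)| + δ * ‖T‖ * LF * dist y z) ∧
                    (∀ x : X, |T (F x) - g x| < ε) ∧
                    ENNReal.ofReal (1 - η) ≤ μ E ∧ (g '' E).Finite := by
  obtain ⟨N, hN⟩ := exists_nat_gt (max (1 / η) 1)
  have hN2 : 2 ≤ N := by
    have : (1 : ℝ) < N := (le_max_right _ _).trans_lt hN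
    exact_mod_cast this
  have hN0 : (0 : ℝ) < N := by positivity
  have hNη : (N : ℝ)⁻¹ ≤ η := by
    rw [inv_le_comm₀ hN0 hη.1, ← one_div]
    exact (le_max_left _ _).trans hN.le
  set δ' : ℝ := min (δ / N) (1 / 2)
  have hδ'pos : 0 < δ' := by positivity
  have hδ'half : δ' ≤ 1 / 2 := min_le_right _ _
  have hNδ' : N * δ' ≤ δ := by
    rw [← le_div_iff₀' hN0]
    exact min_le_left _ _
  refine ⟨1 - δ', ⟨by linarith, by linarith⟩, ?_⟩
  intro X V _ _ _ _ _ _ S hS F LF hF W hnull T hT ε hε μ hμ hμS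
  have hTF : LipschitzWith (‖T‖₊ * LF) (fun x => T (F x)) := T.lipschitz.comp hF
  have hμS1 : μ S = 1 := by
    rw [← prob_compl_eq_zero_iff hS.measurableSet]
    exact hμS
  rcases (show 0 ≤ ‖T‖ * LF by positivity).eq_or_lt with hM | hM
  · have hconst : ∀ y z, T (F y) = T (F z) := fun y z => by
      have := hTF.dist_le_mul y z
      rw [NNReal.coe_mul, coe_nnnorm, ← hM, zero_mul] at this
      exact dist_le_zero.1 this
    refine ⟨fun x => T (F x), S, subset_rfl, hS, fun y z => ?_, fun x => by simpa using hε, ?_, ?_⟩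
    · exact le_add_of_nonneg_right (by positivity)
    · rw [hμS1]
      exact ENNReal.ofReal_le_one.2 (by linarith [hη.1])
    · refine Set.Subsingleton.finite ?_
      rintro _ ⟨y, -, rfl⟩ _ ⟨z, -, rfl⟩
      exact hconst y z
  have : CompactSpace S := isCompact_iff_compactSpace.1 hS
  set f : S → ℝ := fun y => T (F y) with hf
  have hfL : LipschitzWith (‖T‖₊ * LF * 1) f := hTF.comp (LipschitzWith.subtype_val S)
  set κ : ℝ := δ' * (‖T‖ * LF) with hκ
  have hκpos : 0 < κ := by positivity
  obtain ⟨r, hr, hchain⟩ := exists_scale_sub_le_sum_jumpCost hfL hκpos (ε := ε / 4) (by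
    intro K γ L h hK hK01 hγ hh
    have := ae_abs_deriv_le_of_null_fragments hF (by linarith : 1 - δ' ≤ 1) hnull hT hK hK01
      (γ := fun t => (γ t : X)) (L := L)
      (LipschitzOnWith.of_dist_le_mul fun s hs t ht => hγ.dist_le_mul s hs t ht)
      (fun t _ => (γ t).2) hh
    rwa [sub_sub_cancel] at this) (by positivity)
  obtain ⟨f₁, hf₁, hff₁⟩ := exists_close_locally_lipschitz hchain
  have hν : ∀ A : Set S, μ.comap Subtype.val A = μ (Subtype.val '' A) := fun A =>
    (MeasurableEmbedding.subtype_coe hS.measurableSet).comap_apply μ A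
  have : IsProbabilityMeasure (μ.comap (Subtype.val : S → X)) :=
    ⟨by rw [hν, Set.image_univ, Subtype.range_coe, hμS1]⟩
  obtain ⟨g₀, E, hE, hνE, hfin, hg₀close, hg₀⟩ :=
    exists_finite_valued_approximation (μ.comap (Subtype.val : S → X)) hκpos hr
      (show 0 < ε / 4 by positivity) hfL.continuous hf₁ hN2
  have hμE : ENNReal.ofReal (1 - η) ≤ μ (Subtype.val '' E) := by
    rw [hν] at hνE
    rw [ENNReal.ofReal_sub _ hη.1.le, ENNReal.ofReal_one, tsub_le_iff_left]
    refine hνE.trans (add_le_add_left ?_ _)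
    rw [← ENNReal.ofReal_natCast, ← ENNReal.ofReal_inv_of_pos hN0]
    exact ENNReal.ofReal_le_ofReal hNη
  have hEne : (Subtype.val '' E : Set X).Nonempty := by
    refine nonempty_of_measure_ne_zero (μ := μ) (ne_of_gt (lt_of_lt_of_le ?_ hμE))
    exact ENNReal.ofReal_pos.2 (by linarith [hη.2])
  have hval : Function.extend Subtype.val g₀ 0 ∘ (Subtype.val : S → X) = g₀ :=
    Function.extend_comp Subtype.val_injective g₀ 0
  have hval' : ∀ y : S, Function.extend Subtype.val g₀ 0 (y : X) = g₀ y := congrFun hval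
  obtain ⟨g, hgE, hgclose, hg⟩ := exists_extension_close (f := fun x => T (F x))
    (g₀ := Function.extend Subtype.val g₀ 0) (κ := N * κ) (ε := ε / 2) (by positivity)
    (by positivity) hEne (by
      rintro _ ⟨y, hy, rfl⟩
      rw [hval']
      refine (abs_sub_le _ (f₁ y) _).trans ?_
      linarith [hff₁ y, hg₀close y]) (by
      rintro _ ⟨y, hy, rfl⟩ _ ⟨z, hz, rfl⟩
      rw [hval', hval']
      exact hg₀ y hy z hz)
  refine ⟨g, Subtype.val '' E, Subtype.coe_image_subset S E,
    hE.isCompact.image continuous_subtype_val, fun y z => (hg y z).trans ?_,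
    fun x => (hgclose x).trans_lt (by linarith), hμE, ?_⟩
  · gcongr _ + ?_ * _
    calc N * κ = N * δ' * ‖T‖ * LF := by rw [hκ]; ring
      _ ≤ δ * ‖T‖ * LF := by gcongr
  · rw [hgE.image_eq, ← Set.image_comp, hval]
    exact hfin
end

section
/- Let S be a compact metric space, Y a metric space, s ∈ (0, ∞) and L ∈ [0, ∞). Then the functional f ↦ H^s_∞(f(S)) is upper semicontinuous on Lip_L(S, Y) with respect to the supremum metric, where H^s_∞(A) = inf{ Σ_i diam(A_i)^s : A ⊆ ⋃_i A_i, the cover being countable } denotes the s-dimensional Hausdorff content of A ⊆ Y. -/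
open MeasureTheory

/-- The `s`-dimensional Hausdorff content of a set `A` in a metric space. -/
noncomputable def hausdorffContent {Y : Type*} [PseudoEMetricSpace Y] (s : ℝ) (A : Set Y) :
    ENNReal :=
  ⨅ (t : ℕ → Set Y) (_ : A ⊆ ⋃ n, t n), ∑' n, EMetric.diam (t n) ^ s

open Filter Topology in
/-- A set has open thickenings whose diameter to the power `s` is barely larger. -/
theorem exists_isOpen_superset_ediam_rpow_lt {Y : Type*} [PseudoEMetricSpace Y] {s : ℝ}
    (hs : 0 ≤ s) (A : Set Y) {c : ENNReal} (hc : Metric.ediam A ^ s < c) :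
    ∃ U, IsOpen U ∧ A ⊆ U ∧ Metric.ediam U ^ s < c := by
  have hcont : Continuous fun δ : NNReal => (Metric.ediam A + 2 * (δ : ENNReal)) ^ s :=
    ENNReal.continuous_rpow_const.comp <| continuous_const.add <|
      (ENNReal.continuous_const_mul (by simp)).comp ENNReal.continuous_coe
  have hsmall : ∀ᶠ δ : NNReal in 𝓝[>] 0, (Metric.ediam A + 2 * (δ : ENNReal)) ^ s < c :=
    (hcont.tendsto 0).mono_left nhdsWithin_le_nhds |>.eventually_lt_const (by simpa using hc)
  obtain ⟨δ, hδc, hδ⟩ := (hsmall.and self_mem_nhdsWithin).exists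
  exact ⟨Metric.thickening δ A, Metric.isOpen_thickening,
    Metric.self_subset_thickening (NNReal.coe_pos.2 hδ) A,
    (ENNReal.rpow_le_rpow (Metric.ediam_thickening_le δ) hs).trans_lt hδc⟩

/-- Hausdorff content is outer regular with respect to open sets. -/
theorem exists_isOpen_superset_hausdorffContent_lt {Y : Type*} [PseudoEMetricSpace Y] {s : ℝ}
    (hs : 0 ≤ s) {A : Set Y} {c : ENNReal} (hc : hausdorffContent s A < c) :
    ∃ U, IsOpen U ∧ A ⊆ U ∧ hausdorffContent s U < c := by
  simp only [hausdorffContent, iInf_lt_iff] at hc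
  obtain ⟨t, hAt, ht⟩ := hc
  obtain ⟨ε, hε, hsum⟩ := ENNReal.exists_pos_sum_of_countable (tsub_pos_of_lt ht).ne' ℕ
  have hfin (n : ℕ) : Metric.ediam (t n) ^ s ≠ ⊤ := ENNReal.ne_top_of_tsum_ne_top ht.ne_top n
  choose U hUo htU hU using fun n => exists_isOpen_superset_ediam_rpow_lt hs (t n)
    (ENNReal.lt_add_right (hfin n) (ENNReal.coe_pos.2 (hε n)).ne')
  refine ⟨⋃ n, U n, isOpen_iUnion hUo, hAt.trans (Set.iUnion_mono htU), ?_⟩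
  calc hausdorffContent s (⋃ n, U n)
      ≤ ∑' n, Metric.ediam (U n) ^ s := iInf₂_le U (Set.Subset.refl _)
    _ ≤ ∑' n, (Metric.ediam (t n) ^ s + ε n) := ENNReal.tsum_le_tsum fun n => (hU n).le
    _ = ∑' n, Metric.ediam (t n) ^ s + ∑' n, (ε n : ENNReal) := ENNReal.tsum_add
    _ < c := lt_tsub_iff_left.1 hsum

/-- Hausdorff content is monotone. -/
theorem hausdorffContent_mono {Y : Type*} [PseudoEMetricSpace Y] (s : ℝ) {A B : Set Y}
    (h : A ⊆ B) : hausdorffContent s A ≤ hausdorffContent s B :=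
  le_iInf₂ fun t ht => iInf₂_le t (h.trans ht)

/-- Let `S` be a compact metric space, `Y` a metric space, `s ∈ (0, ∞)` and `L ≥ 0`. The
functional `f ↦ H^s_∞(f(S))` is upper semicontinuous on `Lip_L(S, Y)` with the supremum
metric. -/
theorem stmt_13 {S Y : Type*} [MetricSpace S] [CompactSpace S] [MetricSpace Y]
    (s : ℝ) (hs : 0 < s) (L : NNReal) :
    UpperSemicontinuous
      (fun f : {g : BoundedContinuousFunction S Y // LipschitzWith L ⇑g} =>
        hausdorffContent s (Set.range ⇑f.1)) := by
  intro f c hc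
  obtain ⟨U, hUo, hfU, hU⟩ := exists_isOpen_superset_hausdorffContent_lt hs.le hc
  obtain ⟨δ, hδ, hδU⟩ :=
    (isCompact_range f.1.continuous).exists_thickening_subset_open hUo hfU
  filter_upwards [Metric.ball_mem_nhds f hδ] with g hg
  refine (hausdorffContent_mono s ?_).trans_lt hU
  rintro _ ⟨x, rfl⟩
  exact hδU <| Metric.mem_thickening_iff.2
    ⟨f.1 x, Set.mem_range_self x, (BoundedContinuousFunction.dist_coe_le_dist x).trans_lt hg⟩
end

section
/- Let X be a finite-dimensional real normed space, a < b, and γ : [a,b] → X a Lipschitz curve such that for almost every t ∈ [a,b], γ is differentiable at t with ‖γ'(t)‖ = 1. Set u = (γ(b) − γ(a))/(b − a). Let ε > 0 and let f : γ([a,b]) → X be 1-Lipschitz with ‖f(x) − x‖ ≤ ε for all x ∈ γ([a,b]). Let φ be a continuous linear functional on X with ‖φ‖ = 1 and φ(u) = ‖u‖, and set A = 1 − ‖u‖ + 2ε/(b − a). Then the set of t ∈ [a,b] at which f∘γ is differentiable with φ((f∘γ)'(t)) > 1 − √A has Lebesgue measure at least (1 − √A)(b − a). -/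
open MeasureTheory
open Filter Topology

/-- A function whose increments at `x` are dominated by those of `g` has the smaller derivative. -/
theorem HasDerivAt.norm_le_of_eventually_norm_sub_le {E F : Type*} [NormedAddCommGroup E]
    [NormedSpace ℝ E] [NormedAddCommGroup F] [NormedSpace ℝ F] {f : ℝ → E} {g : ℝ → F}
    {f' : E} {g' : F} {x : ℝ} (hf : HasDerivAt f f' x) (hg : HasDerivAt g g' x)
    (h : ∀ᶠ y in 𝓝 x, ‖f y - f x‖ ≤ ‖g y - g x‖) : ‖f'‖ ≤ ‖g'‖ := by
  refine le_of_tendsto_of_tendsto (hasDerivAt_iff_tendsto_slope.1 hf).norm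
    (hasDerivAt_iff_tendsto_slope.1 hg).norm ?_
  filter_upwards [h.filter_mono nhdsWithin_le_nhds] with y hy
  simp only [slope_def_module, norm_smul]
  gcongr

/-- Markov's inequality for the defect `1 - h'` of a Lipschitz function with derivative
at most `1`. -/
theorem LipschitzOnWith.mul_measureReal_one_sub_deriv_ge_le {K : NNReal} {h : ℝ → ℝ} {a b : ℝ}
    (hab : a ≤ b) (hh : LipschitzOnWith K h (Set.Icc a b))
    (hle : ∀ᵐ t ∂(volume.restrict (Set.Icc a b)), deriv h t ≤ 1) (c : ℝ) :
    c * (volume.restrict (Set.Icc a b)).real {t | c ≤ 1 - deriv h t} ≤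
      (b - a) - (h b - h a) := by
  have hac : AbsolutelyContinuousOnInterval h a b :=
    LipschitzOnWith.absolutelyContinuousOnInterval (by rwa [Set.uIcc_of_le hab])
  have hint : Integrable (deriv h) (volume.restrict (Set.Icc a b)) :=
    (intervalIntegrable_iff_integrableOn_Icc_of_le hab).1 hac.intervalIntegrable_deriv
  have hmarkov := mul_meas_ge_le_integral_of_nonneg (μ := volume.restrict (Set.Icc a b))
    (f := fun t => 1 - deriv h t) (by filter_upwards [hle] with t ht using sub_nonneg.2 ht)
    ((integrable_const 1).sub hint) c
  rwa [integral_sub (integrable_const 1) hint, integral_Icc_eq_integral_Ioc (f := deriv h),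
    ← intervalIntegral.integral_of_le hab, hac.integral_deriv_eq_sub, integral_const,
    smul_eq_mul, mul_one, measureReal_restrict_apply_univ, Real.volume_real_Icc_of_le hab]
    at hmarkov

/-- A 1-Lipschitz image of an a.e. unit speed curve is a.e. differentiable, with speed at most
one. -/
theorem LipschitzOnWith.ae_exists_hasDerivAt_comp_norm_le_one {X Y : Type*}
    [NormedAddCommGroup X] [NormedSpace ℝ X] [NormedAddCommGroup Y] [NormedSpace ℝ Y]
    [FiniteDimensional ℝ Y] {a b : ℝ} {γ : ℝ → X} {L : NNReal}
    (hγ : LipschitzOnWith L γ (Set.Icc a b))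
    (hspeed : ∀ᵐ t ∂(volume.restrict (Set.Icc a b)),
      ∃ v, HasDerivWithinAt γ v (Set.Icc a b) t ∧ ‖v‖ = 1)
    {f : X → Y} (hf : LipschitzOnWith 1 f (γ '' Set.Icc a b)) :
    ∀ᵐ t ∂(volume.restrict (Set.Icc a b)), ∃ w, HasDerivAt (f ∘ γ) w t ∧ ‖w‖ ≤ 1 := by
  have hg := hf.comp hγ (Set.mapsTo_image γ _)
  have hne (c : ℝ) : ∀ᵐ t ∂(volume.restrict (Set.Icc a b)), t ≠ c :=
    ae_restrict_of_ae (Measure.ae_ne volume c)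
  filter_upwards [hspeed, hg.ae_differentiableWithinAt_real measurableSet_Icc, hne a, hne b,
    ae_restrict_mem measurableSet_Icc] with t ⟨v, hv, hv1⟩ hd hta htb ht
  have hnhds : Set.Icc a b ∈ 𝓝 t :=
    Icc_mem_nhds (lt_of_le_of_ne ht.1 hta.symm) (lt_of_le_of_ne ht.2 htb)
  have hw := (hd.differentiableAt hnhds).hasDerivAt
  refine ⟨_, hw, hv1 ▸ hw.norm_le_of_eventually_norm_sub_le (hv.hasDerivAt hnhds) ?_⟩
  filter_upwards [hnhds] with s hs
  simpa [dist_eq_norm] using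
    hf.dist_le_mul _ (Set.mem_image_of_mem γ hs) _ (Set.mem_image_of_mem γ ht)

/-- Let `γ : [a,b] → X` be a Lipschitz curve of a.e. unit speed in a finite-dimensional normed
space, `u = (γ(b) − γ(a))/(b − a)`, `f` 1-Lipschitz on `γ([a,b])` with `‖f − id‖ ≤ ε`, and
`φ` a norming functional of `u`. With `A = 1 − ‖u‖ + 2ε/(b − a)`, the set of `t` at which
`f ∘ γ` is differentiable with `φ((f∘γ)'(t)) > 1 − √A` has measure at least
`(1 − √A)(b − a)`. -/
theorem stmt_17 {X : Type*} [NormedAddCommGroup X] [NormedSpace ℝ X] [FiniteDimensional ℝ X]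
    (a b : ℝ) (hab : a < b) (γ : ℝ → X) (Lγ : NNReal)
    (hγ : LipschitzOnWith Lγ γ (Set.Icc a b))
    (hspeed : ∀ᵐ t ∂(volume.restrict (Set.Icc a b)),
      ∃ v, HasDerivWithinAt γ v (Set.Icc a b) t ∧ ‖v‖ = 1)
    (u : X) (hu : u = (b - a)⁻¹ • (γ b - γ a))
    (ε : ℝ) (hε : 0 < ε)
    (f : X → X) (hf : LipschitzOnWith 1 f (γ '' Set.Icc a b))
    (hfclose : ∀ x ∈ γ '' Set.Icc a b, ‖f x - x‖ ≤ ε)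
    (φ : X →L[ℝ] ℝ) (hφnorm : ‖φ‖ = 1) (hφu : φ u = ‖u‖)
    (A : ℝ) (hA : A = 1 - ‖u‖ + 2 * ε / (b - a)) :
    ENNReal.ofReal ((1 - Real.sqrt A) * (b - a)) ≤
      volume {t ∈ Set.Icc a b |
        ∃ w, HasDerivWithinAt (f ∘ γ) w (Set.Icc a b) t ∧ 1 - Real.sqrt A < φ w} := by
  have hba : 0 < b - a := sub_pos.2 hab
  have hφle (w : X) : φ w ≤ ‖w‖ := by
    simpa [hφnorm] using (le_abs_self _).trans (φ.le_opNorm w)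
  have hlip {g : ℝ → X} {K : NNReal} (hg : LipschitzOnWith K g (Set.Icc a b)) :
      LipschitzOnWith (‖φ‖₊ * K) (φ ∘ g) (Set.Icc a b) := φ.lipschitz.comp_lipschitzOnWith hg
  have hφderiv {g : ℝ → X} {w : X} {t : ℝ} (hw : HasDerivAt g w t) :
      deriv (φ ∘ g) t = φ w := (φ.hasFDerivAt.comp_hasDerivAt t hw).deriv
  have hφγ : φ (γ b) - φ (γ a) = (b - a) * ‖u‖ := by
    rw [← hφu, hu, map_smul, map_sub, smul_eq_mul, mul_inv_cancel_left₀ hba.ne']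
  have hu1 : ‖u‖ ≤ 1 := by
    have hγ1 := hγ.ae_exists_hasDerivAt_comp_norm_le_one hspeed
      (f := id) (LipschitzWith.id.lipschitzOnWith)
    have := (hlip hγ).mul_measureReal_one_sub_deriv_ge_le hab.le (by
      filter_upwards [hγ1] with t ⟨w, hw, hw1⟩
      rw [hφderiv (g := γ) hw]
      exact (hφle w).trans hw1) 0
    simp only [Function.comp_apply, hφγ] at this
    nlinarith
  have hApos : 0 < A := by
    have : 0 < 2 * ε / (b - a) := by positivity
    linarith
  have hgder := hγ.ae_exists_hasDerivAt_comp_norm_le_one hspeed hf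
  have hmarkov := (hlip (hf.comp hγ (Set.mapsTo_image γ _))).mul_measureReal_one_sub_deriv_ge_le
    hab.le (by
      filter_upwards [hgder] with t ⟨w, hw, hw1⟩
      rw [hφderiv hw]
      exact (hφle w).trans hw1) √A
  set μ := volume.restrict (Set.Icc a b)
  set B := {t | √A ≤ 1 - deriv (φ ∘ f ∘ γ) t}
  have hdefect : (b - a) - (φ (f (γ b)) - φ (f (γ a))) ≤ A * (b - a) := by
    have hb := (hφle _).trans ((norm_sub_rev _ _).trans_le
      (hfclose (γ b) (Set.mem_image_of_mem γ (Set.right_mem_Icc.2 hab.le))))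
    have ha := (hφle _).trans
      (hfclose (γ a) (Set.mem_image_of_mem γ (Set.left_mem_Icc.2 hab.le)))
    have hAba : A * (b - a) = (b - a) - (b - a) * ‖u‖ + 2 * ε := by
      rw [hA]
      field_simp
    rw [map_sub] at ha hb
    linarith
  have hBle : μ.real B ≤ √A * (b - a) := by
    refine le_of_mul_le_mul_left ?_ (Real.sqrt_pos.2 hApos)
    rw [← mul_assoc, Real.mul_self_sqrt hApos.le]
    exact hmarkov.trans hdefect
  set G := {t ∈ Set.Icc a b |
    ∃ w, HasDerivWithinAt (f ∘ γ) w (Set.Icc a b) t ∧ 1 - √A < φ w}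
  have hcover : ∀ᵐ t ∂μ, t ∈ B ∪ G := by
    filter_upwards [hgder, ae_restrict_mem measurableSet_Icc] with t ⟨w, hw, _⟩ ht
    by_cases hB : √A ≤ 1 - φ w
    · exact Or.inl (by simpa only [B, Set.mem_ofPred_eq, hφderiv hw] using hB)
    · exact Or.inr ⟨ht, w, hw.hasDerivWithinAt, by linarith⟩
  have htotal : μ.real Set.univ = b - a := by
    rw [measureReal_restrict_apply_univ, Real.volume_real_Icc_of_le hab.le]
  have hsum : b - a ≤ μ.real B + μ.real G := by
    rw [← htotal, ← measureReal_congr (eventuallyEq_univ.2 hcover)]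
    exact measureReal_union_le B G
  calc ENNReal.ofReal ((1 - √A) * (b - a)) ≤ ENNReal.ofReal (μ.real G) :=
        ENNReal.ofReal_le_ofReal (by linarith)
    _ = μ G := ofReal_measureReal
    _ ≤ volume G := Measure.restrict_apply_le _ _
end

section
/- Let X be a finite-dimensional real normed space, a < b, and γ : [a,b] → X a continuously differentiable curve with ‖γ'(t)‖ = 1 for all t ∈ [a,b]. Then for every s < 1 and every ε > 0 there exists a partition a = t₀ < t₁ < … < t_k = b such that for every i ∈ {1, …, k}: ‖γ(t_i) − γ(t_{i−1})‖/(t_i − t_{i−1}) > s, and ‖γ'(t) − (γ(t_i) − γ(t_{i−1}))/(t_i − t_{i−1})‖ < ε for every t ∈ [t_{i−1}, t_i]. -/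
/-- If `f'` stays within `C` of `v` on `[c, d]`, then so does the slope of `f` on `[c, d]`. -/
theorem norm_sub_slope_le_of_norm_deriv_sub_le {E : Type*} [NormedAddCommGroup E]
    [NormedSpace ℝ E] {f f' : ℝ → E} {c d C : ℝ} {v : E} (hcd : c < d)
    (hf : ∀ x ∈ Set.Icc c d, HasDerivWithinAt f (f' x) (Set.Icc c d) x)
    (hC : ∀ x ∈ Set.Icc c d, ‖f' x - v‖ ≤ C) :
    ‖v - (d - c)⁻¹ • (f d - f c)‖ ≤ C := by
  have hpos : 0 < d - c := sub_pos.2 hcd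
  have key := norm_image_sub_le_of_norm_deriv_le_segment'
    (f := fun x => f x - x • v) (f' := fun x => f' x - v)
    (fun x hx => by simpa using (hf x hx).fun_sub ((hasDerivWithinAt_id x _).smul_const v))
    (fun x hx => hC x (Set.Ico_subset_Icc_self hx)) d (Set.right_mem_Icc.2 hcd.le)
  have heq : v - (d - c)⁻¹ • (f d - f c)
      = -((d - c)⁻¹ • ((f d - d • v) - (f c - c • v))) := by
    have : (f d - d • v) - (f c - c • v) = (f d - f c) - (d - c) • v := by module
    rw [this, smul_sub _ (f d - f c), inv_smul_smul₀ hpos.ne']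
    abel
  rw [heq, norm_neg, norm_smul, norm_inv, Real.norm_of_nonneg hpos.le, inv_mul_le_iff₀ hpos]
  linarith

/-- Partition lemma: a `C¹` unit-speed curve `γ : [a,b] → X` in a finite-dimensional normed
space admits, for every `s < 1` and `ε > 0`, a partition `a = t₀ < t₁ < … < t_k = b` such that
on each subinterval the slope exceeds `s` and the derivative stays `ε`-close to the chord
direction. -/
theorem stmt_18 {X : Type*} [NormedAddCommGroup X] [NormedSpace ℝ X] [FiniteDimensional ℝ X]
    (a b : ℝ) (hab : a < b) (γ γ' : ℝ → X)
    (hderiv : ∀ t ∈ Set.Icc a b, HasDerivWithinAt γ (γ' t) (Set.Icc a b) t)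
    (hcont : ContinuousOn γ' (Set.Icc a b))
    (hunit : ∀ t ∈ Set.Icc a b, ‖γ' t‖ = 1)
    (s : ℝ) (hs : s < 1) (ε : ℝ) (hε : 0 < ε) :
    ∃ (k : ℕ) (t : ℕ → ℝ), 0 < k ∧ t 0 = a ∧ t k = b ∧
      (∀ i < k, t i < t (i + 1)) ∧
      ∀ i : ℕ, 1 ≤ i → i ≤ k →
        s < ‖γ (t i) - γ (t (i - 1))‖ / (t i - t (i - 1)) ∧
        ∀ x ∈ Set.Icc (t (i - 1)) (t i),
          ‖γ' x - (t i - t (i - 1))⁻¹ • (γ (t i) - γ (t (i - 1)))‖ < ε := by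
  obtain ⟨η, hη, hηm⟩ := exists_between (lt_min hε (sub_pos.2 hs))
  obtain ⟨hηε, hηs⟩ := lt_min_iff.1 hηm
  obtain ⟨δ, hδ, huc⟩ := Metric.uniformContinuousOn_iff.1
    (isCompact_Icc.uniformContinuousOn_of_continuous hcont) η hη
  obtain ⟨n, hn⟩ := exists_nat_gt ((b - a) / δ)
  have hba : 0 < b - a := sub_pos.2 hab
  have hn0 : (0 : ℝ) < n := (div_pos hba hδ).trans hn
  have hstep : 0 < (b - a) / n := div_pos hba hn0
  have hmesh : (b - a) / n < δ := by
    rw [div_lt_iff₀ hδ] at hn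
    rw [div_lt_iff₀ hn0]
    linarith
  have hend : a + n * ((b - a) / n) = b := by
    rw [mul_div_cancel₀ _ hn0.ne']
    ring
  refine ⟨n, fun i => a + i * ((b - a) / n), by exact_mod_cast hn0, by simp, hend, ?_, ?_⟩
  · intro i _
    push_cast
    linarith
  intro i hi hin
  obtain ⟨j, rfl⟩ : ∃ j, i = j + 1 := ⟨i - 1, by omega⟩
  simp only [Nat.add_sub_cancel]
  set c := a + (j : ℝ) * ((b - a) / n) with hc
  set d := a + ((j + 1 : ℕ) : ℝ) * ((b - a) / n) with hd
  have hdc : d - c = (b - a) / n := by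
    rw [hc, hd]
    push_cast
    ring
  have hcd : c < d := by linarith
  have hac : a ≤ c := by
    have : 0 ≤ (j : ℝ) * ((b - a) / n) := by positivity
    linarith
  have hdb : d ≤ b := by
    rw [hd]
    nth_rw 2 [← hend]
    gcongr
  have hsub : Set.Icc c d ⊆ Set.Icc a b := Set.Icc_subset_Icc hac hdb
  have hclose : ∀ x ∈ Set.Icc c d, ‖γ' x - (d - c)⁻¹ • (γ d - γ c)‖ ≤ η := by
    intro x hx
    refine norm_sub_slope_le_of_norm_deriv_sub_le hcd
      (fun y hy => (hderiv y (hsub hy)).mono hsub) fun y hy => ?_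
    rw [← dist_eq_norm]
    refine (huc y (hsub hy) x (hsub hx) ?_).le
    exact ((Real.dist_le_of_mem_Icc hy hx).trans_eq hdc).trans_lt hmesh
  refine ⟨?_, fun x hx => (hclose x hx).trans_lt hηε⟩
  have hmem : c ∈ Set.Icc c d := Set.left_mem_Icc.2 hcd.le
  have hslope : ‖(d - c)⁻¹ • (γ d - γ c)‖ = ‖γ d - γ c‖ / (d - c) := by
    rw [norm_smul, norm_inv, Real.norm_of_nonneg (sub_pos.2 hcd).le, inv_mul_eq_div]
  have := norm_sub_norm_le (γ' c) ((d - c)⁻¹ • (γ d - γ c))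
  rw [hunit c (hsub hmem), hslope] at this
  linarith [hclose c hmem]
end

section
/- Let X be a finite-dimensional strictly convex real normed space, a < b, and γ : [a,b] → X a continuously differentiable curve with ‖γ'(t)‖ = 1 for all t ∈ [a,b]. Then for every δ > 0 there exists ε > 0 such that: whenever f : γ([a,b]) → X is 1-Lipschitz with ‖f(x) − x‖ < ε for all x ∈ γ([a,b]), the set of t ∈ [a,b] at which f∘γ is differentiable with ‖(f∘γ)'(t) − γ'(t)‖ ≥ δ has Lebesgue measure at most δ·(b − a). -/
open MeasureTheory

/-- A finite-dimensional strictly convex space is uniformly convex. -/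
theorem UniformConvexSpace.of_finiteDimensional (X : Type*) [NormedAddCommGroup X]
    [NormedSpace ℝ X] [FiniteDimensional ℝ X] [StrictConvexSpace ℝ X] :
    UniformConvexSpace X where
  uniform_convex ε hε := by
    have : ProperSpace X := FiniteDimensional.proper ℝ X
    let K : Set (X × X) :=
      (Metric.closedBall 0 1 ×ˢ Metric.closedBall 0 1) ∩ {p | ε ≤ ‖p.1 - p.2‖}
    have hK : IsCompact K :=
      ((isCompact_closedBall _ _).prod (isCompact_closedBall _ _)).inter_right
        (isClosed_le continuous_const (by fun_prop))
    have hmem {x y : X} (hx : ‖x‖ = 1) (hy : ‖y‖ = 1) (hxy : ε ≤ ‖x - y‖) : (x, y) ∈ K :=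
      ⟨⟨by simp [hx], by simp [hy]⟩, hxy⟩
    rcases K.eq_empty_or_nonempty with h | h
    · refine ⟨1, one_pos, fun x hx y hy hxy => ?_⟩
      simpa [h] using hmem hx hy hxy
    · obtain ⟨p, hp, hmax⟩ := hK.exists_isMaxOn h
        (f := fun p : X × X => ‖p.1 + p.2‖) (by fun_prop)
      have hne : p.1 ≠ p.2 := by
        intro he
        have := hp.2
        simp only [Set.mem_ofPred_eq, he, sub_self, norm_zero] at this
        linarith
      have hlt := combo_mem_ball_of_ne hp.1.1 hp.1.2 hne (one_half_pos (α := ℝ)) one_half_pos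
        (by norm_num)
      rw [← smul_add, mem_ball_zero_iff, norm_smul, Real.norm_of_nonneg (by norm_num)] at hlt
      refine ⟨2 - ‖p.1 + p.2‖, by linarith, fun x hx y hy hxy => ?_⟩
      have : ‖x + y‖ ≤ ‖p.1 + p.2‖ := hmax (hmem hx hy hxy)
      linarith

/-- A monotone function increases by at least `η` times the measure of any set on whose interior
points its derivative is at least `η`. -/
theorem MonotoneOn.mul_measureReal_le_sub {k : ℝ → ℝ} {c d η : ℝ} (hcd : c ≤ d) (hη : 0 ≤ η)
    (hk : MonotoneOn k (Set.Icc c d)) {S : Set ℝ} (hS : S ⊆ Set.Icc c d)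
    (hSk : ∀ t ∈ S, t ∈ Set.Ioo c d → η ≤ deriv k t) :
    η * volume.real S ≤ k d - k c := by
  have hkcd : k c ≤ k d := hk (Set.left_mem_Icc.2 hcd) (Set.right_mem_Icc.2 hcd) hcd
  have hk' : MonotoneOn k (Set.uIcc c d) := by rwa [Set.uIcc_of_le hcd]
  have hint : IntegrableOn (deriv k) (Set.Ioo c d) :=
    ((intervalIntegrable_iff_integrableOn_Ioc_of_le hcd).1 hk'.intervalIntegrable_deriv).mono_set
      Set.Ioo_subset_Ioc_self
  have hnonneg : 0 ≤ᵐ[volume.restrict (Set.Ioo c d)] deriv k := by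
    filter_upwards [ae_restrict_mem measurableSet_Ioo] with t ht
    have : 0 ≤ derivWithin k (Set.Icc c d) t := hk.derivWithin_nonneg
    rwa [derivWithin_of_mem_nhds (Icc_mem_nhds ht.1 ht.2)] at this
  have hmarkov := mul_meas_ge_le_integral_of_nonneg hnonneg hint η
  have hle : ∫ t in Set.Ioo c d, deriv k t ≤ k d - k c := by
    have h := hk'.intervalIntegral_deriv_mem_uIcc
    rw [Set.uIcc_of_le (by linarith), intervalIntegral.integral_of_le hcd,
      integral_Ioc_eq_integral_Ioo] at h
    exact h.2
  rw [measureReal_restrict_apply (measurableSet_le measurable_const (measurable_deriv k))]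
    at hmarkov
  refine le_trans ?_ (hmarkov.trans hle)
  refine mul_le_mul_of_nonneg_left ?_ hη
  have hsub : S ⊆ ({t | η ≤ deriv k t} ∩ Set.Ioo c d) ∪ {c, d} := by
    intro t ht
    rcases (hS ht).1.eq_or_lt with h | h
    · simp [h]
    rcases (hS ht).2.eq_or_lt with h' | h'
    · simp [h']
    exact Or.inl ⟨hSk t ht ⟨h, h'⟩, h, h'⟩
  have hnull : volume.real ({c, d} : Set ℝ) = 0 := by
    simp [measureReal_def, (Set.toFinite {c, d}).measure_zero volume]
  have hfin : volume ({t | η ≤ deriv k t} ∩ Set.Ioo c d ∪ {c, d}) ≠ ⊤ := by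
    refine measure_ne_top_of_subset ?_ (isCompact_Icc (a := c) (b := d)).measure_lt_top.ne
    exact Set.union_subset (Set.inter_subset_right.trans Set.Ioo_subset_Icc_self)
      (Set.pair_subset (Set.left_mem_Icc.2 hcd) (Set.right_mem_Icc.2 hcd))
  calc volume.real S ≤ volume.real ({t | η ≤ deriv k t} ∩ Set.Ioo c d ∪ {c, d}) :=
        measureReal_mono hsub hfin
    _ ≤ _ := (measureReal_union_le _ _).trans (by rw [hnull, add_zero])

/-- If a curve `γ` has velocity `κ`-close to the unit vector `u` on `[c, d]`, then a `1`-Lipschitz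
curve `g` that is `ε`-close to `γ` has velocity `ρ`-close to `u` outside a set of small measure. -/
theorem mul_measureReal_velocity_far_le {X : Type*} [NormedAddCommGroup X] [NormedSpace ℝ X]
    {c d ε κ η ρ : ℝ} (hcd : c ≤ d) (hη : 0 ≤ η) {u : X} (hu : ‖u‖ = 1)
    (huc : ∀ ⦃w : X⦄, ‖w‖ ≤ 1 → ρ ≤ ‖u - w‖ → ‖u + w‖ ≤ 2 - η)
    {γ γ' g : ℝ → X} (hγ : ∀ t ∈ Set.Icc c d, HasDerivWithinAt γ (γ' t) (Set.Icc c d) t)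
    (hκ : ∀ t ∈ Set.Icc c d, ‖γ' t - u‖ ≤ κ) (hg : LipschitzOnWith 1 g (Set.Icc c d))
    (hclose : ∀ t ∈ Set.Icc c d, ‖g t - γ t‖ ≤ ε) {S : Set ℝ} (hS : S ⊆ Set.Icc c d)
    (hfar : ∀ t ∈ S, ∃ w, HasDerivWithinAt g w (Set.Icc c d) t ∧ ρ ≤ ‖u - w‖) :
    η * volume.real S ≤ κ * (d - c) + 2 * ε := by
  obtain ⟨φ, hφ, hφu⟩ := exists_dual_vector'' ℝ u
  have hφle (x : X) : φ x ≤ ‖x‖ :=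
    (le_abs_self _).trans ((φ.le_opNorm x).trans (mul_le_of_le_one_left (norm_nonneg x) hφ))
  have hφu' : φ u = 1 := by simpa [hu] using hφu
  have hc : c ∈ Set.Icc c d := Set.left_mem_Icc.2 hcd
  have hd : d ∈ Set.Icc c d := Set.right_mem_Icc.2 hcd
  have hmono : MonotoneOn (fun t => t - φ (g t)) (Set.Icc c d) := by
    intro s hs t ht hst
    have h1 := hφle (g t - g s)
    have h2 := hg.norm_sub_le ht hs
    rw [Real.norm_of_nonneg (sub_nonneg.2 hst), NNReal.coe_one, one_mul] at h2
    rw [map_sub] at h1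
    change s - φ (g s) ≤ t - φ (g t)
    linarith
  refine (hmono.mul_measureReal_le_sub hcd hη hS ?_).trans ?_
  · intro t ht hto
    obtain ⟨w, hw, hwu⟩ := hfar t ht
    have hnhds := Icc_mem_nhds hto.1 hto.2
    have hw' := hw.hasDerivAt hnhds
    have hw1 : ‖w‖ ≤ 1 := by simpa using hw'.le_of_lipschitzOn hnhds hg
    have hder : HasDerivAt (fun t => t - φ (g t)) (1 - φ w) t :=
      (hasDerivAt_id t).sub (φ.hasFDerivAt.comp_hasDerivAt t hw')
    have h1 := (hφle (u + w)).trans (huc hw1 hwu)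
    rw [map_add, hφu'] at h1
    rw [hder.deriv]
    linarith
  · have hmv := (convex_Icc c d).norm_image_sub_le_of_norm_hasDerivWithin_le
      (f := fun t => γ t - t • u) (f' := fun t => γ' t - (1 : ℝ) • u)
      (fun t ht => (hγ t ht).sub ((hasDerivWithinAt_id t _).smul_const u))
      (fun t ht => by simpa using hκ t ht) hc hd
    rw [Real.norm_of_nonneg (sub_nonneg.2 hcd), norm_sub_rev] at hmv
    have h1 := (hφle _).trans hmv
    have h2 := (hφle _).trans ((norm_sub_rev _ _).trans_le (hclose d hd))
    have h3 := (hφle _).trans (hclose c hc)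
    simp only [map_sub, map_smul, hφu', smul_eq_mul, mul_one] at h1 h2 h3 ⊢
    linarith

/-- A set meeting each of the intervals `[a + i h, a + (i + 1) h]`, `i < n`, in measure at most `C`
meets `[a, a + n h]` in measure at most `n C`. -/
theorem measureReal_inter_Icc_le_natCast_mul {B : Set ℝ} {a h C : ℝ} (n : ℕ)
    (hB : ∀ i < n, volume.real (B ∩ Set.Icc (a + i * h) (a + (i + 1) * h)) ≤ C) :
    volume.real (B ∩ Set.Icc a (a + n * h)) ≤ n * C := by
  induction n with
  | zero =>
    have : volume (B ∩ {a}) = 0 := measure_mono_null Set.inter_subset_right (by simp)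
    simp [measureReal_def, this]
  | succ n ih =>
    have hsub : B ∩ Set.Icc a (a + (n + 1) * h) ⊆
        (B ∩ Set.Icc a (a + n * h)) ∪ (B ∩ Set.Icc (a + n * h) (a + (n + 1) * h)) := by
      rw [← Set.inter_union_distrib_left]
      exact Set.inter_subset_inter_right _ Set.Icc_subset_Icc_union_Icc
    have hfin (x y : ℝ) : volume (B ∩ Set.Icc x y) ≠ ⊤ :=
      measure_ne_top_of_subset Set.inter_subset_right (by simp)
    push_cast
    calc _ ≤ _ := measureReal_mono hsub (measure_union_ne_top (hfin _ _) (hfin _ _))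
      _ ≤ _ := measureReal_union_le _ _
      _ ≤ n * C + C := add_le_add (ih fun i hi => hB i (by omega)) (hB n (by omega))
      _ = _ := by ring

/-- Let `γ : [a,b] → X` be a `C¹` unit-speed curve in a finite-dimensional strictly convex
real normed space. For every `δ > 0` there is `ε > 0` such that for every 1-Lipschitz
`f : γ([a,b]) → X` uniformly `ε`-close to the identity, the set of `t` at which `f ∘ γ` is
differentiable with `‖(f∘γ)'(t) − γ'(t)‖ ≥ δ` has Lebesgue measure at most `δ(b − a)`. -/
theorem stmt_19 {X : Type*} [NormedAddCommGroup X] [NormedSpace ℝ X]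
    [FiniteDimensional ℝ X] [StrictConvexSpace ℝ X]
    (a b : ℝ) (hab : a < b) (γ γ' : ℝ → X)
    (hderiv : ∀ t ∈ Set.Icc a b, HasDerivWithinAt γ (γ' t) (Set.Icc a b) t)
    (hcont : ContinuousOn γ' (Set.Icc a b))
    (hunit : ∀ t ∈ Set.Icc a b, ‖γ' t‖ = 1)
    (δ : ℝ) (hδ : 0 < δ) :
    ∃ ε > (0 : ℝ), ∀ f : X → X, LipschitzOnWith 1 f (γ '' Set.Icc a b) →
      (∀ x ∈ γ '' Set.Icc a b, ‖f x - x‖ < ε) →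
      volume {t ∈ Set.Icc a b |
          ∃ w, HasDerivWithinAt (f ∘ γ) w (Set.Icc a b) t ∧ δ ≤ ‖w - γ' t‖} ≤
        ENNReal.ofReal (δ * (b - a)) := by
  have := UniformConvexSpace.of_finiteDimensional X
  obtain ⟨η, hη, huc⟩ := exists_forall_closed_ball_dist_add_le_two_sub X (half_pos hδ)
  obtain ⟨κ, hκ, hκδ, hκη⟩ : ∃ κ : ℝ, 0 < κ ∧ κ ≤ δ / 2 ∧ κ ≤ η * δ / 2 :=
    ⟨min (δ / 2) (η * δ / 2), by positivity, min_le_left _ _, min_le_right _ _⟩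
  obtain ⟨r, hr, hunif⟩ := Metric.uniformContinuousOn_iff.1
    (isCompact_Icc.uniformContinuousOn_of_continuous hcont) κ hκ
  obtain ⟨N, hN⟩ := exists_nat_gt ((b - a) / r)
  have hba : 0 < b - a := sub_pos.2 hab
  have hN0 : (0 : ℝ) < N := lt_trans (by positivity) hN
  set h : ℝ := (b - a) / N with hh
  have hh0 : 0 < h := by positivity
  have hhr : h < r := by rw [hh, div_lt_comm₀ hN0 hr]; exact hN
  have hNh : N * h = b - a := by rw [hh]; field_simp
  refine ⟨η * δ * h / 4, by positivity, fun f hf hclose => ?_⟩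
  set B := {t ∈ Set.Icc a b |
    ∃ w, HasDerivWithinAt (f ∘ γ) w (Set.Icc a b) t ∧ δ ≤ ‖w - γ' t‖}
  have hγlip : LipschitzOnWith 1 γ (Set.Icc a b) :=
    (convex_Icc a b).lipschitzOnWith_of_nnnorm_hasDerivWithin_le hderiv
      fun t ht => by simpa [← NNReal.coe_le_coe] using (hunit t ht).le
  have hglip : LipschitzOnWith 1 (f ∘ γ) (Set.Icc a b) := by
    simpa using hf.comp hγlip (Set.mapsTo_image γ _)
  have hpiece : ∀ i < N, volume.real (B ∩ Set.Icc (a + i * h) (a + (i + 1) * h)) ≤ δ * h := by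
    intro i hi
    have hi' : ((i : ℝ) + 1) * h ≤ N * h := by
      gcongr
      exact_mod_cast hi
    have hsub : Set.Icc (a + i * h) (a + (i + 1) * h) ⊆ Set.Icc a b :=
      Set.Icc_subset_Icc (by linarith [show 0 ≤ i * h by positivity]) (by linarith)
    have hle : a + i * h ≤ a + (i + 1) * h := by linarith
    have hleft := Set.left_mem_Icc.2 hle
    have hnear : ∀ t ∈ Set.Icc (a + i * h) (a + (i + 1) * h), ‖γ' t - γ' (a + i * h)‖ ≤ κ := by
      intro t ht
      rw [← dist_eq_norm]
      refine (hunif t (hsub ht) _ (hsub hleft) ?_).le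
      rw [Real.dist_eq, abs_of_nonneg (by linarith [ht.1])]
      linarith [ht.2]
    have key := mul_measureReal_velocity_far_le hle hη.le (hunit _ (hsub hleft))
      (fun w hw => huc (hunit _ (hsub hleft)).le hw)
      (fun t ht => (hderiv t (hsub ht)).mono hsub) hnear (hglip.mono hsub)
      (fun t ht => (hclose _ (Set.mem_image_of_mem γ (hsub ht))).le)
      (S := B ∩ Set.Icc (a + i * h) (a + (i + 1) * h)) Set.inter_subset_right (by
        rintro t ⟨⟨-, w, hw, hwδ⟩, ht⟩
        refine ⟨w, hw.mono hsub, ?_⟩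
        have h1 := norm_sub_le_norm_sub_add_norm_sub w (γ' (a + i * h)) (γ' t)
        rw [norm_sub_rev w (γ' (a + i * h)), norm_sub_rev (γ' (a + i * h)) (γ' t)] at h1
        linarith [hnear t ht])
    have h2 : κ * h ≤ η * δ / 2 * h := by gcongr
    refine le_of_mul_le_mul_left (key.trans ?_) hη
    linarith
  have htotal := measureReal_inter_Icc_le_natCast_mul N hpiece
  rw [hNh, add_sub_cancel, Set.inter_eq_left.2 (Set.sep_subset _ _),
    show N * (δ * h) = δ * (b - a) by rw [← hNh]; ring] at htotal
  have hfin : volume B ≠ ⊤ := measure_ne_top_of_subset (Set.sep_subset _ _) (by simp)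
  exact (ENNReal.le_ofReal_iff_toReal_le hfin (by positivity)).2 htotal
end
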